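/- Let M = g⁻¹(0) be a nonempty compact hypersurface in ℝ⁴ contained in the open unit ball B⁴ = {x ∈ ℝ⁴ : |x| < 1} (g : ℝ⁴ → ℝ smooth with dg_x ≠ 0 for all x ∈ M), and suppose M is transverse to the radial vector field, i.e. dg_x(x) ≠ 0 for all x ∈ M (so that λ_st restricts to a contact form on M). Then λ_st|TM has a closed Reeb orbit of period T with 0 < T ≤ π that is contractible in M: there exist such a T and a nonconstant smooth map γ : ℝ → ℝ⁴ with image in M such that for all t ∈ ℝ one has γ(t + T) = γ(t), γ′(t) ∈ ker(dg_{γ(t)}), ω_st(γ′(t), v) = 0 for all v ∈ ker(dg_{γ(t)}), and ½·ω_st(γ(t), γ′(t)) = 1, and the loop [0, T] → M, t ↦ γ(t), is null-homotopic as a loop in the subspace M. -/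

import Mathlib

noncomputable section

open scoped ContDiff unitInterval
open Real

/-- ℝ⁴ with the Euclidean inner product. -/
abbrev R4 : Type := EuclideanSpace ℝ (Fin 4)

/-- The standard symplectic form ω_st = dx₁∧dy₁ + dx₂∧dy₂ on ℝ⁴. -/
def omegaSt (u v : R4) : ℝ := u 0 * v 1 - u 1 * v 0 + u 2 * v 3 - u 3 * v 2

/-- `det (1 + A)` is an affine combination, with weights independent of `A`, of the values
`det (1 + t A)` at any `dim + 1` prescribed nodes `t`. -/
theorem det_one_add_eq_sum_nodes {E : Type*} [NormedAddCommGroup E] [NormedSpace ℝ E]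
    [FiniteDimensional ℝ E] (t : ℕ → ℝ) (ht : Function.Injective t) :
    ∃ c : ℕ → ℝ, ∑ j ∈ Finset.range (Module.finrank ℝ E + 1), c j = 1 ∧
      ∀ A : E →L[ℝ] E, (ContinuousLinearMap.id ℝ E + A).det =
        ∑ j ∈ Finset.range (Module.finrank ℝ E + 1),
          c j * (ContinuousLinearMap.id ℝ E + t j • A).det := by
  classical
  set n := Module.finrank ℝ E
  set s := Finset.range (n + 1)
  have hinj : Set.InjOn t s := ht.injOn
  refine ⟨fun j => (Lagrange.basis s t j).eval 1, ?_, fun A => ?_⟩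
  · rw [← Polynomial.eval_finsetSum, Lagrange.sum_basis hinj ⟨0, by simp [s]⟩, Polynomial.eval_one]
  · let b := Module.finBasis ℝ E
    let M := LinearMap.toMatrix b b (A : E →ₗ[ℝ] E)
    let p : Polynomial ℝ :=
      ((Polynomial.X : Polynomial ℝ) • M.map Polynomial.C +
        (1 : Matrix (Fin n) (Fin n) ℝ).map Polynomial.C).det
    have hdeg : p.natDegree ≤ n := by
      have h := Polynomial.natDegree_det_X_add_C_le M 1
      rwa [Fintype.card_fin] at h
    have hp : ∀ r : ℝ, (ContinuousLinearMap.id ℝ E + r • A).det = p.eval r := by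
      intro r
      have h1 : p.eval r = (1 + r • M).det := by
        rw [← Polynomial.coe_evalRingHom, RingHom.map_det]
        congr 1
        ext i j
        by_cases hij : i = j <;> simp [hij] <;> ring
      rw [h1, ContinuousLinearMap.det, ← LinearMap.det_toMatrix b]
      congr 1
      ext i j
      simp [M, LinearMap.toMatrix_apply, Matrix.one_apply, Finsupp.single_apply, eq_comm]
    have h1 := hp 1
    rw [one_smul] at h1
    rw [h1]
    have h_int : p = Lagrange.interpolate s t fun i => p.eval (t i) := by
      apply Lagrange.eq_interpolate_of_eval_eq _ hinj
      · refine lt_of_le_of_lt Polynomial.degree_le_natDegree ?_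
        simp only [s, Finset.card_range]
        exact_mod_cast Nat.lt_succ_of_le hdeg
      · intro i _; rfl
    conv_lhs => rw [h_int]
    rw [Lagrange.interpolate_apply, Polynomial.eval_finsetSum]
    refine Finset.sum_congr rfl fun j _ => ?_
    rw [hp]
    simp [mul_comm]

/-- A map that is Lipschitz on the unit ball and vanishes on its boundary stays Lipschitz when it
is extended by zero. -/
theorem lipschitzWith_indicator_closedBall {E F : Type*} [NormedAddCommGroup E] [NormedSpace ℝ E]
    [NormedAddCommGroup F] {g : E → F} {K : NNReal}
    (hg : LipschitzOnWith K g (Metric.closedBall 0 1)) (h0 : ∀ x, ‖x‖ = 1 → g x = 0) :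
    LipschitzWith K ((Metric.closedBall (0 : E) 1).indicator g) := by
  have key : ∀ x y : E, ‖x‖ ≤ 1 → 1 < ‖y‖ → ‖g x‖ ≤ K * ‖x - y‖ := by
    intro x y hx hy
    obtain ⟨s, hs, hs1⟩ : (1 : ℝ) ∈ (fun s : ℝ => ‖x + s • (y - x)‖) '' Set.Icc 0 1 := by
      apply intermediate_value_Icc zero_le_one (by fun_prop)
      constructor <;> simp [hx, hy.le]
    simp only at hs1
    have h1 := hg.norm_sub_le (x := x) (y := x + s • (y - x)) (by simpa using hx)
      (by simp [hs1])
    rw [h0 _ hs1, sub_zero] at h1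
    refine h1.trans ?_
    gcongr
    rw [sub_add_cancel_left, norm_neg, norm_smul, norm_sub_rev y x, Real.norm_of_nonneg hs.1]
    exact mul_le_of_le_one_left (norm_nonneg _) hs.2
  apply LipschitzWith.of_dist_le_mul
  intro x y
  rw [dist_eq_norm, dist_eq_norm]
  by_cases hx : ‖x‖ ≤ 1 <;> by_cases hy : ‖y‖ ≤ 1
  · rw [Set.indicator_of_mem (by simpa using hx), Set.indicator_of_mem (by simpa using hy)]
    exact hg.norm_sub_le (by simpa using hx) (by simpa using hy)
  · rw [Set.indicator_of_mem (by simpa using hx), Set.indicator_of_notMem (by simpa using hy),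
      sub_zero]
    exact key x y hx (not_le.1 hy)
  · rw [Set.indicator_of_notMem (by simpa using hx), Set.indicator_of_mem (by simpa using hy),
      zero_sub, norm_neg, norm_sub_rev]
    exact key y x hy (not_le.1 hx)
  · rw [Set.indicator_of_notMem (by simpa using hx), Set.indicator_of_notMem (by simpa using hy)]
    simp only [sub_self, norm_zero]
    positivity

open MeasureTheory in
/-- There is no `C¹` map to the unit sphere that restricts to the identity on the sphere. -/
theorem no_contDiff_retraction_sphere {E : Type*} [NormedAddCommGroup E] [InnerProductSpace ℝ E]
    [FiniteDimensional ℝ E] {r : E → E} (hr : ContDiff ℝ 1 r) (hr1 : ∀ x, ‖r x‖ = 1)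
    (hrs : ∀ x, ‖x‖ = 1 → r x = x) : False := by
  borelize E
  set B := Metric.closedBall (0 : E) 1 with hB
  have hBc : IsCompact B := isCompact_closedBall 0 1
  set g : E → E := fun x => r x - x with hgdef
  have hg : ContDiff ℝ 1 g := hr.sub contDiff_id
  set A : E → E →L[ℝ] E := fderiv ℝ g with hA
  have hAc : Continuous A := hg.continuous_fderiv one_ne_zero
  have hgd : ∀ x, HasFDerivAt g (A x) x := fun x => (hg.differentiable one_ne_zero x).hasFDerivAt
  obtain ⟨K, hK⟩ : ∃ K, LipschitzOnWith K g B := by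
    obtain ⟨C, hC⟩ := hBc.exists_bound_of_continuousOn hAc.continuousOn
    refine ⟨C.toNNReal, (convex_closedBall (0 : E) 1).lipschitzOnWith_of_nnnorm_fderiv_le
      (𝕜 := ℝ) (fun x _ => hg.differentiable one_ne_zero x) fun x hx => ?_⟩
    rw [← NNReal.coe_le_coe, coe_nnnorm]
    exact (hC x hx).trans (Real.le_coe_toNNReal C)
  have hgs : ∀ x, ‖x‖ = 1 → g x = 0 := fun x hx => by simp [hgdef, hrs x hx]
  have hL := lipschitzWith_indicator_closedBall hK hgs
  have himage : ∀ t : ℝ, 0 ≤ t → t ≤ 1 → t * K < 1 →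
      (Function.Injective fun x => x + t • B.indicator g x) ∧
        (fun x => x + t • B.indicator g x) '' B = B := by
    intro t ht0 ht1 htK
    have happ : ApproximatesLinearOn (fun x => x + t • B.indicator g x)
        ((ContinuousLinearEquiv.refl ℝ E : E ≃L[ℝ] E) : E →L[ℝ] E) Set.univ (t.toNNReal * K) := by
      rw [ApproximatesLinearOn.approximatesLinearOn_iff_lipschitzOnWith, lipschitzOnWith_univ]
      have h1 : ((fun x => x + t • B.indicator g x) -
          (((ContinuousLinearEquiv.refl ℝ E : E ≃L[ℝ] E) : E →L[ℝ] E) : E → E)) =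
          fun x => t • B.indicator g x := by
        ext x; simp
      rw [h1]
      apply LipschitzWith.of_dist_le_mul
      intro x y
      rw [dist_smul₀, NNReal.coe_mul, mul_assoc, Real.coe_toNNReal _ ht0, Real.norm_of_nonneg ht0]
      gcongr
      exact hL.dist_le_mul x y
    have hc : Subsingleton E ∨ t.toNNReal * K <
        ‖(((ContinuousLinearEquiv.refl ℝ E).symm : E ≃L[ℝ] E) : E →L[ℝ] E)‖₊⁻¹ := by
      rcases subsingleton_or_nontrivial E with h | h
      · exact Or.inl h
      · right
        have h2 : ‖(((ContinuousLinearEquiv.refl ℝ E).symm : E ≃L[ℝ] E) : E →L[ℝ] E)‖₊ = 1 := by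
          ext; simp
        rw [h2, inv_one, ← NNReal.coe_lt_coe]
        simpa [ht0] using htK
    refine ⟨Set.injOn_univ.1 (happ.injOn hc), Set.Subset.antisymm ?_ ?_⟩
    · rintro _ ⟨x, hx, rfl⟩
      have hx' : ‖x‖ ≤ 1 := by simpa [hB] using hx
      simp only [Set.indicator_of_mem hx, hgdef]
      have h3 : x + t • (r x - x) = (1 - t) • x + t • r x := by module
      rw [h3, hB, mem_closedBall_zero_iff]
      refine (norm_add_le _ _).trans ?_
      rw [norm_smul, norm_smul, hr1, Real.norm_of_nonneg ht0, Real.norm_of_nonneg (by linarith)]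
      nlinarith
    · intro y hy
      obtain ⟨x, hx⟩ := happ.surjective hc y
      by_cases hxB : x ∈ B
      · exact ⟨x, hxB, hx⟩
      · simp only [Set.indicator_of_notMem hxB, smul_zero, add_zero] at hx
        exact absurd (hx ▸ hy) hxB
  have hdetc : Continuous fun p : ℝ × E =>
      (ContinuousLinearMap.id ℝ E + p.1 • A p.2).det := by
    apply ContinuousLinearMap.continuous_det.comp
    fun_prop
  have hev : ∀ᶠ t : ℝ in nhds 0, ∀ x ∈ B, 0 < (ContinuousLinearMap.id ℝ E + t • A x).det := by
    apply hBc.eventually_forall_of_forall_eventually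
    intro x _
    apply hdetc.continuousAt.eventually_const_lt
    simp [ContinuousLinearMap.det]
  obtain ⟨δ, hδ, hδ'⟩ := Metric.eventually_nhds_iff.1 hev
  obtain ⟨ε, hε, hε1, hεδ, hεK⟩ : ∃ ε : ℝ, 0 < ε ∧ ε ≤ 1 ∧ ε < δ ∧ ε * K < 1 := by
    refine ⟨min (min 1 (δ / 2)) (1 / (K + 2)), by positivity, ?_, ?_, ?_⟩
    · exact (min_le_left _ _).trans (min_le_left _ _)
    · exact lt_of_le_of_lt ((min_le_left _ _).trans (min_le_right _ _)) (by linarith)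
    · have : min (min 1 (δ / 2)) (1 / ((K : ℝ) + 2)) * K ≤ 1 / ((K : ℝ) + 2) * K := by
        gcongr; exact min_le_right _ _
      refine lt_of_le_of_lt this ?_
      rw [one_div, inv_mul_lt_one₀ (by positivity)]
      linarith
  have h_int : ∀ t : ℝ, 0 ≤ t → t ≤ ε →
      ∫ x in B, (ContinuousLinearMap.id ℝ E + t • A x).det = (volume B).toReal := by
    intro t ht0 htε
    obtain ⟨hinj, him⟩ := himage t ht0 (htε.trans hε1)
      (lt_of_le_of_lt (by gcongr) hεK)
    have heq : Set.EqOn (fun x => x + t • g x) (fun x => x + t • B.indicator g x) B := by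
      intro x hx
      simp [Set.indicator_of_mem hx]
    have h1 := integral_image_eq_integral_abs_det_fderiv_smul (volume : Measure E)
      (f := fun x => x + t • g x) (f' := fun x => ContinuousLinearMap.id ℝ E + t • A x)
      (s := B) hBc.measurableSet
      (fun x _ => ((hasFDerivAt_id x).add ((hgd x).const_smul t)).hasFDerivWithinAt)
      (heq.injOn_iff.2 hinj.injOn) (fun _ => (1 : ℝ))
    rw [heq.image_eq, him] at h1
    simp only [smul_eq_mul, mul_one] at h1
    have h2 : ∫ x in B, |(ContinuousLinearMap.id ℝ E + t • A x).det| =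
        ∫ x in B, (ContinuousLinearMap.id ℝ E + t • A x).det := by
      refine setIntegral_congr_fun hBc.measurableSet fun x hx => ?_
      refine abs_of_pos (hδ' ?_ x hx)
      rw [Real.dist_eq, sub_zero, abs_of_nonneg ht0]
      linarith
    rw [← h2, ← h1]
    simp [Measure.real]
  have hnodes : ∀ j : ℕ, 0 ≤ ε / (j + 1) ∧ ε / ((j : ℝ) + 1) ≤ ε := fun j =>
    ⟨by positivity, div_le_self hε.le (by linarith [Nat.cast_nonneg (α := ℝ) j])⟩
  obtain ⟨c, hc1, hc⟩ := det_one_add_eq_sum_nodes (E := E) (fun j : ℕ => ε / ((j : ℝ) + 1))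
    (by
      intro i j hij
      have hi : (0 : ℝ) < i + 1 := by positivity
      have hj : (0 : ℝ) < j + 1 := by positivity
      simp only at hij
      rw [div_eq_div_iff hi.ne' hj.ne'] at hij
      have := mul_left_cancel₀ hε.ne' hij
      exact_mod_cast (add_right_cancel this).symm)
  have hone : ∫ x in B, (ContinuousLinearMap.id ℝ E + A x).det = (volume B).toReal := by
    rw [funext fun x => hc (A x)]
    rw [integral_finsetSum]
    · simp_rw [integral_const_mul]
      rw [Finset.sum_congr rfl fun j _ => by rw [h_int _ (hnodes j).1 (hnodes j).2],
        ← Finset.sum_mul, hc1, one_mul]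
    · intro j _
      apply Integrable.const_mul
      apply ContinuousOn.integrableOn_compact hBc
      exact (hdetc.comp (by fun_prop : Continuous fun x : E => (ε / ((j : ℝ) + 1), x))).continuousOn
  have hzero : ∀ x, (ContinuousLinearMap.id ℝ E + A x).det = 0 := by
    intro x
    have hd : HasFDerivAt r (ContinuousLinearMap.id ℝ E + A x) x := by
      have h1 := (hasFDerivAt_id x).add (hgd x)
      have h2 : (id + g) = r := by ext y; simp [hgdef]
      rwa [h2] at h1
    have h3 : HasFDerivAt (fun y => ‖r y‖ ^ 2) (0 : E →L[ℝ] ℝ) x := by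
      simp_rw [hr1]
      exact hasFDerivAt_const _ _
    have h4 := h3.unique hd.norm_sq
    rw [ContinuousLinearMap.det]
    by_contra hne
    have hunit := (LinearMap.isUnit_iff_isUnit_det _).2 (isUnit_iff_ne_zero.2 hne)
    obtain ⟨v, hv⟩ := ((Module.End.isUnit_iff _).1 hunit).2 (r x)
    have h5 := congrArg (fun L : E →L[ℝ] ℝ => L v) h4
    have hv' : (ContinuousLinearMap.id ℝ E + A x) v = r x := hv
    simp only [zero_apply, smul_apply,
      ContinuousLinearMap.comp_apply, hv', innerSL_apply_apply, real_inner_self_eq_norm_sq,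
      hr1] at h5
    norm_num at h5
  simp_rw [hzero] at hone
  simp only [integral_zero] at hone
  have hpos : 0 < volume B := Metric.measure_closedBall_pos _ _ one_pos
  have := ENNReal.toReal_pos hpos.ne' hBc.measure_lt_top.ne
  linarith

/-- A continuous self-map of a Euclidean space that is the identity outside the unit ball has a
zero. -/
theorem exists_zero_of_eq_id_outside_ball {E : Type*} [NormedAddCommGroup E]
    [InnerProductSpace ℝ E] [FiniteDimensional ℝ E] {G : E → E} (hG : Continuous G)
    (hid : ∀ x, 1 ≤ ‖x‖ → G x = x) : ∃ x, G x = 0 := by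
  by_contra! hne
  obtain ⟨G', hG', hdist, heq, -⟩ := hG.exists_contDiff_approx_and_eqOn 1
    (ε := fun x => ‖G x‖) hG.norm (fun x => norm_pos_iff.2 (hne x))
    (S := {x | 2 ≤ ‖x‖}) (U := {x | 1 < ‖x‖})
    (isClosed_le continuous_const continuous_norm)
    ((isOpen_lt continuous_const continuous_norm).mem_nhdsSet.2 fun x (hx : 2 ≤ ‖x‖) => by
      simp only [Set.mem_ofPred_eq]; linarith)
    (contDiffOn_id.congr fun x hx => hid x (le_of_lt hx))
  have hG'ne : ∀ x, G' x ≠ 0 := by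
    intro x hx
    have := hdist x
    simp [hx] at this
  have hsm : ContDiff ℝ 1 fun x => G' ((2 : ℝ) • x) := hG'.comp (contDiff_const_smul 2)
  refine no_contDiff_retraction_sphere (E := E)
    (r := fun x => ‖G' ((2 : ℝ) • x)‖⁻¹ • G' ((2 : ℝ) • x)) ?_ ?_ ?_
  · exact ((hsm.norm ℝ fun x => hG'ne _).inv fun x => norm_ne_zero_iff.2 (hG'ne _)).smul hsm
  · intro x
    rw [norm_smul, norm_inv, norm_norm, inv_mul_cancel₀ (norm_ne_zero_iff.2 (hG'ne _))]
  · intro x hx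
    have h2 : ‖(2 : ℝ) • x‖ = 2 := by rw [norm_smul, hx]; norm_num
    have h3 : G' ((2 : ℝ) • x) = (2 : ℝ) • x := by
      rw [heq (show (2 : ℝ) ≤ ‖(2 : ℝ) • x‖ from h2.ge), hid _ (by rw [h2]; norm_num)]
    simp only [h3, h2]
    rw [smul_smul]; norm_num

open scoped InnerProductSpace in
/-- Linking principle for nonlinear eigenvalues: a quadratic form `½⟪L u, u⟫` and a positive
`2`-homogeneous function `h` with gradient `F` have an eigenvector `L u = T F u` with `T ∈ [m, b]`,
provided the quotient of the two is nonpositive on `W`, at most `b` on `W ⊕ ℝ e`, and at least `m`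
on the orthogonal complement of `W`. -/
theorem exists_nonlinear_eigenvector {V : Type*} [NormedAddCommGroup V] [InnerProductSpace ℝ V]
    [FiniteDimensional ℝ V] (L : V →L[ℝ] V) (hL : ∀ x y, ⟪L x, y⟫_ℝ = ⟪x, L y⟫_ℝ)
    (h : V → ℝ) (F : V → V) (hF : Continuous F) (C : ℝ)
    (hC : ∀ u v, |h v - h u - ⟪F u, v - u⟫_ℝ| ≤ C * ‖v - u‖ ^ 2)
    (hhom : ∀ (c : ℝ) u, 0 ≤ c → h (c • u) = c ^ 2 * h u)
    (hFhom : ∀ (c : ℝ) u, 0 ≤ c → F (c • u) = c • F u)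
    (hEuler : ∀ u, ⟪F u, u⟫_ℝ = 2 * h u) (hh : ∀ u, ‖u‖ ^ 2 ≤ h u)
    (W : Submodule ℝ V) (e : V) (heW : e ∈ Wᗮ) (he : e ≠ 0) (m b : ℝ) (hm : 0 < m)
    (hW : ∀ w ∈ W, ⟪L w, w⟫_ℝ ≤ 0) (hWperp : ∀ w ∈ Wᗮ, m * h w ≤ 1 / 2 * ⟪L w, w⟫_ℝ)
    (hWe : ∀ w ∈ W, ∀ s : ℝ,
      1 / 2 * ⟪L (w + s • e), w + s • e⟫_ℝ ≤ b * h (w + s • e)) :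
    ∃ (u : V) (T : ℝ), h u = 1 ∧ m ≤ T ∧ T ≤ b ∧ L u = T • F u := by
  set A : V → ℝ := fun u => 1 / 2 * ⟪L u, u⟫_ℝ with hA
  set Q : V → ℝ := fun u => A u / h u with hQ
  have hpos : ∀ u, u ≠ 0 → 0 < h u := fun u hu =>
    lt_of_lt_of_le (pow_pos (norm_pos_iff.2 hu) 2) (hh u)
  have hQh : ∀ u, u ≠ 0 → Q u * h u = A u := fun u hu => div_mul_cancel₀ _ (hpos u hu).ne'
  by_contra! hno
  have hno' : ∀ u, u ≠ 0 → m ≤ Q u → Q u ≤ b → L u ≠ Q u • F u := by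
    intro u hu h1 h2 h3
    have hsq : 0 < √(h u) := Real.sqrt_pos.2 (hpos u hu)
    refine hno ((√(h u))⁻¹ • u) (Q u) ?_ h1 h2 ?_
    · rw [hhom _ _ (by positivity), inv_pow, Real.sq_sqrt (hpos u hu).le,
        inv_mul_cancel₀ (hpos u hu).ne']
    · rw [hFhom _ _ (by positivity), map_smul, h3, smul_comm]
  have hhcont : Continuous h := by
    have h1 : h = fun u => 1 / 2 * ⟪F u, u⟫_ℝ := by ext u; rw [hEuler]; ring
    rw [h1]; fun_prop
  have hAcont : Continuous A := by simp only [hA]; fun_prop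
  have hQcont : ∀ u, u ≠ 0 → ContinuousAt Q u := fun u hu =>
    hAcont.continuousAt.div hhcont.continuousAt (hpos u hu).ne'
  have hAbd : ∀ u, |A u| ≤ ‖L‖ * ‖u‖ ^ 2 := by
    intro u
    have h1 : |⟪L u, u⟫_ℝ| ≤ ‖L‖ * ‖u‖ ^ 2 := by
      refine (abs_real_inner_le_norm _ _).trans ?_
      rw [pow_two, ← mul_assoc]
      gcongr
      exact L.le_opNorm u
    simp only [hA, abs_mul]
    rw [abs_of_pos (by norm_num : (0 : ℝ) < 1 / 2)]
    nlinarith [abs_nonneg ⟪L u, u⟫_ℝ]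
  have hQbd : ∀ u, |Q u| ≤ ‖L‖ := by
    intro u
    by_cases hu : u = 0
    · simp [hQ, hA, hu]
    · simp only [hQ, abs_div, abs_of_pos (hpos u hu)]
      rw [div_le_iff₀ (hpos u hu)]
      exact (hAbd u).trans (by gcongr; exact hh u)
  have hF0 : F 0 = 0 := by simpa using hFhom 0 0 le_rfl
  set Y : V → V := fun u => L u - Q u • F u with hY
  have hYcont : Continuous Y := by
    rw [continuous_iff_continuousAt]
    intro u
    by_cases hu : u = 0
    · subst hu
      have h0 : Y 0 = 0 := by simp [hY, hF0]
      rw [ContinuousAt, h0, tendsto_zero_iff_norm_tendsto_zero]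
      have h1 : Filter.Tendsto (fun u => ‖L‖ * ‖u‖ + ‖L‖ * ‖F u‖) (nhds (0 : V)) (nhds 0) := by
        have : Continuous fun u => ‖L‖ * ‖u‖ + ‖L‖ * ‖F u‖ := by fun_prop
        simpa [hF0] using this.tendsto 0
      refine squeeze_zero (fun _ => norm_nonneg _) (fun u => ?_) h1
      refine (norm_sub_le _ _).trans ?_
      rw [norm_smul]
      exact add_le_add (L.le_opNorm u) (by gcongr; exact hQbd u)
    · exact L.continuous.continuousAt.sub ((hQcont u hu).smul hF.continuousAt)
  have hYorth : ∀ u, u ≠ 0 → ⟪Y u, u⟫_ℝ = 0 := by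
    intro u hu
    have := hQh u hu
    simp only [hY, inner_sub_left, inner_smul_left, hEuler, conj_trivial]
    simp only [hA] at this
    linarith
  have hQhom : ∀ c : ℝ, 0 < c → ∀ u, Q (c • u) = Q u := by
    intro c hc u
    simp only [hQ, hA, hhom c u hc.le, map_smul, inner_smul_left, inner_smul_right, conj_trivial]
    rw [show 1 / 2 * (c * (c * ⟪L u, u⟫_ℝ)) = c ^ 2 * (1 / 2 * ⟪L u, u⟫_ℝ) by ring]
    exact mul_div_mul_left _ _ (by positivity)
  have hYhom : ∀ c : ℝ, 0 < c → ∀ u, Y (c • u) = c • Y u := by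
    intro c hc u
    simp only [hY, hQhom c hc, hFhom c u hc.le, map_smul, smul_sub]
    rw [smul_comm]
  set D : ℝ → V → V := fun s u => u - s • Y u with hD
  have hDne : ∀ s u, u ≠ 0 → D s u ≠ 0 := by
    intro s u hu h0
    have h1 : ⟪D s u, u⟫_ℝ = ‖u‖ ^ 2 := by
      simp only [hD, inner_sub_left, inner_smul_left, hYorth u hu, conj_trivial,
        real_inner_self_eq_norm_sq]
      ring
    rw [h0, inner_zero_left] at h1
    exact (pow_pos (norm_pos_iff.2 hu) 2).ne h1
  have hC0 : 0 ≤ C := by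
    have h1 := (abs_nonneg _).trans (hC 0 e)
    rw [sub_zero] at h1
    exact nonneg_of_mul_nonneg_left h1 (pow_pos (norm_pos_iff.2 he) 2)
  set κ : ℝ := ‖L‖ + ‖L‖ * C with hκ
  have hκ0 : 0 ≤ κ := by positivity
  have hdesc : ∀ s, 0 ≤ s → s * κ ≤ 1 / 2 → ∀ u, u ≠ 0 →
      A (D s u) - Q u * h (D s u) ≤ -(s / 2) * ‖Y u‖ ^ 2 := by
    intro s hs hsκ u hu
    have h1 : A (D s u) = A u - s * ⟪L u, Y u⟫_ℝ + s ^ 2 * A (Y u) := by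
      simp only [hA, hD, map_sub, map_smul, inner_sub_left, inner_sub_right, inner_smul_left,
        inner_smul_right, conj_trivial]
      rw [hL (Y u) u, real_inner_comm (L u) (Y u)]
      ring
    have h2 : |h (D s u) - h u + s * ⟪F u, Y u⟫_ℝ| ≤ C * (s ^ 2 * ‖Y u‖ ^ 2) := by
      have := hC u (D s u)
      have h3 : D s u - u = -(s • Y u) := by simp [hD]
      rw [h3, inner_neg_right, inner_smul_right, norm_neg, norm_smul, mul_pow,
        Real.norm_eq_abs, sq_abs, sub_neg_eq_add] at this
      exact this
    have h3 : ‖Y u‖ ^ 2 = ⟪L u, Y u⟫_ℝ - Q u * ⟪F u, Y u⟫_ℝ := by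
      rw [← real_inner_self_eq_norm_sq]
      conv_lhs => enter [2]; simp only [hY]
      simp only [inner_sub_left, inner_smul_left, conj_trivial]
    have h4 : |Q u * (h (D s u) - h u + s * ⟪F u, Y u⟫_ℝ)| ≤
        ‖L‖ * (C * (s ^ 2 * ‖Y u‖ ^ 2)) := by
      rw [abs_mul]
      gcongr
      exact hQbd u
    have h5 := (le_abs_self _).trans (hAbd (Y u))
    have h6 := neg_le_of_abs_le h4
    have h7 := hQh u hu
    have h8 : s ^ 2 * A (Y u) ≤ s ^ 2 * (‖L‖ * ‖Y u‖ ^ 2) := by gcongr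
    have h9 : s * κ * (s * ‖Y u‖ ^ 2) ≤ 1 / 2 * (s * ‖Y u‖ ^ 2) := by gcongr
    simp only [hκ] at h9
    linear_combination h6 + h8 + h9 + h1 + s * h3 - h7
  have hmono : ∀ s, 0 ≤ s → s * κ ≤ 1 / 2 → ∀ u, u ≠ 0 → Q (D s u) ≤ Q u := by
    intro s hs hsκ u hu
    have h1 := hdesc s hs hsκ u hu
    simp only [hQ] at h1 ⊢
    rw [div_le_iff₀ (hpos _ (hDne s u hu))]
    nlinarith [sq_nonneg ‖Y u‖, mul_nonneg hs (sq_nonneg ‖Y u‖)]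
  obtain ⟨η, hη, hηκ⟩ : ∃ η : ℝ, 0 < η ∧ η * κ ≤ 1 / 2 := by
    refine ⟨1 / (2 * (κ + 1)), by positivity, ?_⟩
    rw [one_div, inv_mul_le_iff₀ (by positivity)]
    linarith
  have hstrict : ∀ u, u ≠ 0 → m ≤ Q u → Q u ≤ b → Q (D η u) < Q u := by
    intro u hu h1 h2
    have h3 := hdesc η hη.le hηκ u hu
    have h4 : 0 < ‖Y u‖ := norm_pos_iff.2 (sub_ne_zero.2 (hno' u hu h1 h2))
    have h5 : 0 < η / 2 * ‖Y u‖ ^ 2 := by positivity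
    simp only [hQ] at h3 ⊢
    rw [div_lt_iff₀ (hpos _ (hDne η u hu))]
    linarith
  obtain ⟨δ, hδ, hδ'⟩ : ∃ δ > 0, ∀ u, u ≠ 0 → m ≤ Q u → Q u ≤ b → Q (D η u) ≤ Q u - δ := by
    have hQs : ContinuousOn Q (Metric.sphere 0 1) := fun u hu =>
      (hQcont u (ne_zero_of_mem_unit_sphere ⟨u, hu⟩)).continuousWithinAt
    have hK : IsCompact (Metric.sphere (0 : V) 1 ∩ Q ⁻¹' Set.Icc m b) :=
      (isCompact_sphere 0 1).of_isClosed_subset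
        (hQs.preimage_isClosed_of_isClosed Metric.isClosed_sphere isClosed_Icc)
        Set.inter_subset_left
    have hDcont : Continuous (D η) := by simp only [hD]; fun_prop
    have hφ : ContinuousOn (fun u => Q u - Q (D η u))
        (Metric.sphere (0 : V) 1 ∩ Q ⁻¹' Set.Icc m b) := by
      intro u hu
      have hu0 : u ≠ 0 := ne_zero_of_mem_unit_sphere ⟨u, hu.1⟩
      exact ((hQcont u hu0).sub (ContinuousAt.comp (hQcont _ (hDne η u hu0))
        hDcont.continuousAt)).continuousWithinAt
    obtain ⟨δ, hδ, hδ'⟩ := hK.exists_forall_le' hφ (a := 0) (fun u hu =>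
      sub_pos.2 (hstrict u (ne_zero_of_mem_unit_sphere ⟨u, hu.1⟩) hu.2.1 hu.2.2))
    refine ⟨δ, hδ, fun u hu h1 h2 => ?_⟩
    have hc : 0 < ‖u‖⁻¹ := inv_pos.2 (norm_pos_iff.2 hu)
    have h3 := hδ' (‖u‖⁻¹ • u) ⟨by simp [norm_smul, hu], by
      simp only [Set.mem_preimage, hQhom _ hc]; exact ⟨h1, h2⟩⟩
    have h4 : D η (‖u‖⁻¹ • u) = ‖u‖⁻¹ • D η u := by
      simp only [hD, hYhom _ hc, smul_sub]
      rw [smul_comm]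
    rw [h4, hQhom _ hc, hQhom _ hc] at h3
    linarith
  have hiter_ne : ∀ s n u, u ≠ 0 → (D s)^[n] u ≠ 0 := by
    intro s n
    induction n with
    | zero => exact fun u hu => hu
    | succ n ih => intro u hu; rw [Function.iterate_succ_apply]; exact ih _ (hDne s u hu)
  have hiter_mono : ∀ s, 0 ≤ s → s * κ ≤ 1 / 2 → ∀ n u, u ≠ 0 → Q ((D s)^[n] u) ≤ Q u := by
    intro s hs hsκ n
    induction n with
    | zero => exact fun u _ => le_rfl
    | succ n ih =>
      intro u hu
      rw [Function.iterate_succ_apply]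
      exact (ih _ (hDne s u hu)).trans (hmono s hs hsκ u hu)
  have hiter_desc : ∀ n : ℕ, ∀ u, u ≠ 0 → Q u ≤ b →
      Q ((D η)^[n] u) < m ∨ Q ((D η)^[n] u) ≤ b - n * δ := by
    intro n u hu hub
    induction n with
    | zero => right; simpa using hub
    | succ n ih =>
      rw [Function.iterate_succ_apply']
      have hne := hiter_ne η n u hu
      have h1 := hmono η hη.le hηκ _ hne
      rcases lt_or_ge (Q ((D η)^[n] u)) m with h2 | h2
      · exact Or.inl (h1.trans_lt h2)
      · right
        have h3 := hδ' _ hne h2 ((hiter_mono η hη.le hηκ n u hu).trans hub)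
        have h4 := ih.resolve_left (not_lt.2 h2)
        push_cast
        linarith
  obtain ⟨n, hn⟩ : ∃ n : ℕ, b - m < n * δ := by
    obtain ⟨n, hn⟩ := exists_nat_gt ((b - m) / δ)
    exact ⟨n, (div_lt_iff₀ hδ).1 hn⟩
  have hfinal : ∀ u, u ≠ 0 → Q u ≤ b → Q ((D η)^[n] u) < m := by
    intro u hu hub
    rcases hiter_desc n u hu hub with h1 | h1 <;> linarith
  have hiter_cont : ∀ n : ℕ, Continuous fun p : ℝ × V => (D p.1)^[n] p.2 := by
    intro n
    induction n with
    | zero => exact continuous_snd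
    | succ n ih =>
      simp only [Function.iterate_succ_apply']
      have : Continuous fun p : ℝ × V => D p.1 p.2 := by simp only [hD]; fun_prop
      exact this.comp (continuous_fst.prodMk ih)
  set c : W → ℝ := fun w => max (1 - 2 * ‖w‖) 0 with hc
  set θ : W → ℝ := fun w => η * min (max (2 - 2 * ‖w‖) 0) 1 with hθ
  have hθ0 : ∀ w, 0 ≤ θ w := fun w => mul_nonneg hη.le (le_min (le_max_right _ _) zero_le_one)
  have hθκ : ∀ w, θ w * κ ≤ 1 / 2 := by
    intro w
    refine le_trans ?_ hηκ
    gcongr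
    exact mul_le_of_le_one_right hη.le (min_le_right _ _)
  obtain ⟨w, hw⟩ := exists_zero_of_eq_id_outside_ball (E := W)
    (G := fun w => W.orthogonalProjectionOnto ((D (θ w))^[n] ((w : V) + c w • e)))
    (by
      apply W.orthogonalProjectionOnto.continuous.comp
      have hθc : Continuous fun w : W => (θ w, (w : V) + c w • e) := by
        simp only [hθ, hc]; fun_prop
      exact (hiter_cont n).comp hθc)
    (by
      intro w hw
      have h1 : c w = 0 := max_eq_right (by linarith)
      have h2 : θ w = 0 := by
        simp only [hθ]
        rw [max_eq_right (by linarith), min_eq_left zero_le_one, mul_zero]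
      have h3 : D 0 = id := by ext1 u; simp [hD]
      simp [h1, h2, h3])
  rw [Submodule.orthogonalProjectionOnto_eq_zero_iff] at hw
  have hstart : (w : V) + c w • e ≠ 0 := by
    intro h0
    have h1 : ⟪e, (w : V) + c w • e⟫_ℝ = c w * ‖e‖ ^ 2 := by
      rw [inner_add_right, inner_smul_right, real_inner_self_eq_norm_sq,
        Submodule.inner_left_of_mem_orthogonal w.2 heW, zero_add]
    rw [h0, inner_zero_right] at h1
    have h2 : c w = 0 := by
      rcases mul_eq_zero.1 h1.symm with h2 | h2
      · exact h2
      · exact absurd h2 (pow_pos (norm_pos_iff.2 he) 2).ne'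
    rw [h2, zero_smul, add_zero] at h0
    have h3 : w = 0 := Subtype.ext h0
    simp [hc, h3] at h2
  have hlow := hWperp _ hw
  have hvne := hiter_ne (θ w) n _ hstart
  have hQlow : m ≤ Q ((D (θ w))^[n] ((w : V) + c w • e)) :=
    (le_div_iff₀ (hpos _ hvne)).2 hlow
  rcases le_total ‖w‖ (1 / 2) with hwn | hwn
  · have h1 : θ w = η := by
      simp only [hθ]
      rw [min_eq_right (le_max_of_le_left (by linarith)), mul_one]
    rw [h1] at hQlow
    refine absurd (hfinal _ hstart ?_) (not_lt.2 hQlow)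
    exact (div_le_iff₀ (hpos _ hstart)).2 (hWe _ w.2 _)
  · have h1 : c w = 0 := max_eq_right (by linarith)
    have h2 := hiter_mono (θ w) (hθ0 w) (hθκ w) n _ hstart
    have h3 : Q ((w : V) + c w • e) ≤ 0 := by
      rw [h1, zero_smul, add_zero]
      apply div_nonpos_of_nonpos_of_nonneg _ ((sq_nonneg _).trans (hh _))
      have := hW _ w.2
      simp only [hA]; linarith
    linarith

open scoped InnerProductSpace in
/-- `H` is a `2`-homogeneous function with gradient `G`, quadratic remainder bound `C`, linear
growth bound `K` on the gradient, and `H ≥ ‖·‖²`. -/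
structure IsQuadraticHamiltonian {E : Type*} [NormedAddCommGroup E] [InnerProductSpace ℝ E]
    (H : E → ℝ) (G : E → E) (C K : ℝ) : Prop where
  continuous_gradient : Continuous G
  remainder : ∀ u v, |H v - H u - ⟪G u, v - u⟫_ℝ| ≤ C * ‖v - u‖ ^ 2
  homogeneous : ∀ (c : ℝ) u, 0 ≤ c → H (c • u) = c ^ 2 * H u
  gradient_homogeneous : ∀ (c : ℝ) u, 0 ≤ c → G (c • u) = c • G u
  euler : ∀ u, ⟪G u, u⟫_ℝ = 2 * H u
  norm_sq_le : ∀ u, ‖u‖ ^ 2 ≤ H u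
  gradient_le : ∀ u, ‖G u‖ ≤ K * ‖u‖

namespace IsQuadraticHamiltonian

open scoped InnerProductSpace

variable {E : Type*} [NormedAddCommGroup E] [InnerProductSpace ℝ E] {H : E → ℝ} {G : E → E}
  {C K : ℝ}

theorem hasFDerivAt (h : IsQuadraticHamiltonian H G C K) (u : E) :
    HasFDerivAt H (innerSL ℝ (G u)) u := by
  rw [hasFDerivAt_iff_isLittleO]
  have h1 : (fun v => H v - H u - (innerSL ℝ (G u)) (v - u)) =O[nhds u]
      (fun v => ‖v - u‖ ^ 2) := by
    refine Asymptotics.IsBigO.of_bound C (Filter.Eventually.of_forall fun v => ?_)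
    simpa [abs_of_nonneg] using h.remainder u v
  refine h1.trans_isLittleO ?_
  have h2 : (fun v : E => ‖v - u‖ ^ 2) =o[nhds u] (fun v => ‖v - u‖) := by
    have : Filter.Tendsto (fun v : E => ‖v - u‖) (nhds u) (nhds 0) := by
      have : Continuous (fun v : E => ‖v - u‖) := by fun_prop
      simpa using this.tendsto u
    simpa [pow_two] using ((Asymptotics.isLittleO_one_iff ℝ).2 this).mul_isBigO
      (Asymptotics.isBigO_refl (fun v : E => ‖v - u‖) (nhds u))
  exact h2.of_norm_right

theorem continuous (h : IsQuadraticHamiltonian H G C K) : Continuous H :=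
  continuous_iff_continuousAt.2 fun u => (h.hasFDerivAt u).continuousAt

theorem le_mul_norm_sq (h : IsQuadraticHamiltonian H G C K) (u : E) :
    H u ≤ K / 2 * ‖u‖ ^ 2 := by
  have h1 := h.euler u
  have h2 := real_inner_le_norm (G u) u
  have h3 := mul_le_mul_of_nonneg_right (h.gradient_le u) (norm_nonneg u)
  nlinarith

theorem two_le [Nontrivial E] (h : IsQuadraticHamiltonian H G C K) : 2 ≤ K := by
  obtain ⟨u, hu⟩ := exists_ne (0 : E)
  have h1 := h.le_mul_norm_sq u
  have h2 := h.norm_sq_le u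
  have h3 : 0 < ‖u‖ ^ 2 := by positivity
  by_contra! hK
  nlinarith

end IsQuadraticHamiltonian

section TrigPoly

open scoped InnerProductSpace
open MeasureTheory AddCircle

attribute [local instance] InnerProductSpace.complexToReal

variable {E : Type*} [NormedAddCommGroup E] [InnerProductSpace ℂ E]

/-- The trigonometric polynomial with coefficients `a k` for `k ∈ K`. -/
def trigPoly (K : Finset ℤ) (a : K → E) (θ : UnitAddCircle) : E :=
  ∑ k : K, fourier (k : ℤ) θ • a k

theorem continuous_trigPoly (K : Finset ℤ) (a : K → E) : Continuous (trigPoly K a) := by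
  unfold trigPoly
  fun_prop

theorem UnitAddCircle.integrable_of_continuous {F : Type*} [NormedAddCommGroup F]
    {f : UnitAddCircle → F} (hf : Continuous f) : Integrable f haarAddCircle :=
  hf.integrable_of_hasCompactSupport (HasCompactSupport.of_compactSpace f)

theorem integral_inner_trigPoly [CompleteSpace E] (K : Finset ℤ) (a : K → E) {f : UnitAddCircle → E}
    (hf : Continuous f) :
    ∫ θ, ⟪trigPoly K a θ, f θ⟫_ℝ ∂haarAddCircle = ∑ k : K, ⟪a k, fourierCoeff f k⟫_ℝ := by
  have h1 : ∀ θ, ⟪trigPoly K a θ, f θ⟫_ℝ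
      = ∑ k : K, (⟪a k, fourier (-(k : ℤ)) θ • f θ⟫_ℂ).re := by
    intro θ
    rw [real_inner_eq_re_inner ℂ, trigPoly, sum_inner, map_sum]
    refine Finset.sum_congr rfl fun k _ => ?_
    rw [inner_smul_left, inner_smul_right, fourier_neg]
    rfl
  have h2 : ∀ k : K, Continuous fun θ => fourier (-(k : ℤ)) θ • f θ := by
    intro k; fun_prop
  simp_rw [h1]
  rw [integral_finsetSum _ fun k _ => ?_]
  · refine Finset.sum_congr rfl fun k _ => ?_
    have h3 : Integrable (fun θ => ⟪a k, fourier (-(k : ℤ)) θ • f θ⟫_ℂ) haarAddCircle :=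
      UnitAddCircle.integrable_of_continuous (Continuous.inner continuous_const (h2 k))
    rw [real_inner_eq_re_inner ℂ, fourierCoeff,
      ← integral_inner (UnitAddCircle.integrable_of_continuous (h2 k))]
    exact integral_re h3
  · exact UnitAddCircle.integrable_of_continuous
      (Complex.continuous_re.comp (Continuous.inner continuous_const (h2 k)))

theorem fourierCoeff_trigPoly [CompleteSpace E] (K : Finset ℤ) (a : K → E) (k : K) :
    fourierCoeff (trigPoly K a) k = a k := by
  have h0 : trigPoly K a = ∑ j : K, fun θ => fourier (j : ℤ) θ • a j := by
    ext θ; simp [trigPoly]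
  have h1 : ∀ j : K, fourierCoeff (fun θ : UnitAddCircle => fourier (j : ℤ) θ • a j) k
      = if j = k then a j else 0 := by
    intro j
    have h2 : fourierCoeff (fun θ : UnitAddCircle => fourier (j : ℤ) θ • a j) k
        = fourierCoeff (fourier (j : ℤ) : UnitAddCircle → ℂ) k • a j := by
      simp only [fourierCoeff, smul_eq_mul]
      rw [← integral_smul_const]
      simp only [smul_smul]
    rw [h2, fourierCoeff_fourier]
    by_cases hjk : j = k
    · simp [hjk]
    · have : (k : ℤ) ≠ j := fun h => hjk (Subtype.ext h.symm)
      simp [hjk, this]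
  rw [h0, fourierCoeff.sum]
  · rw [Finset.sum_apply, Finset.sum_congr rfl fun j _ => h1 j]
    simp
  · intro j _
    exact UnitAddCircle.integrable_of_continuous (by fun_prop)

theorem integral_norm_sq_trigPoly [CompleteSpace E] (K : Finset ℤ) (a : K → E) :
    ∫ θ, ‖trigPoly K a θ‖ ^ 2 ∂haarAddCircle = ∑ k : K, ‖a k‖ ^ 2 := by
  have := integral_inner_trigPoly K a (continuous_trigPoly K a)
  simpa [fourierCoeff_trigPoly, real_inner_self_eq_norm_sq] using this

theorem sum_norm_sq_fourierCoeff_le [CompleteSpace E] (K : Finset ℤ) {f : UnitAddCircle → E}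
    (hf : Continuous f) :
    ∑ k : K, ‖fourierCoeff f k‖ ^ 2 ≤ ∫ θ, ‖f θ‖ ^ 2 ∂haarAddCircle := by
  obtain ⟨p, hpc, hpf, hpp⟩ : ∃ p : UnitAddCircle → E, Continuous p ∧
      ∫ θ, ⟪p θ, f θ⟫_ℝ ∂haarAddCircle = ∑ k : K, ‖fourierCoeff f k‖ ^ 2 ∧
      ∫ θ, ‖p θ‖ ^ 2 ∂haarAddCircle = ∑ k : K, ‖fourierCoeff f k‖ ^ 2 := by
    refine ⟨trigPoly K fun k => fourierCoeff f k, continuous_trigPoly K _, ?_,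
      integral_norm_sq_trigPoly K _⟩
    rw [integral_inner_trigPoly K _ hf]
    simp only [real_inner_self_eq_norm_sq]
  have h1 : 0 ≤ ∫ θ, ‖f θ - p θ‖ ^ 2 ∂haarAddCircle := integral_nonneg fun θ => by positivity
  have i1 : Integrable (fun θ => ‖f θ‖ ^ 2) (haarAddCircle (T := 1)) :=
    UnitAddCircle.integrable_of_continuous (by fun_prop)
  have i2 : Integrable (fun θ => ‖p θ‖ ^ 2) (haarAddCircle (T := 1)) :=
    UnitAddCircle.integrable_of_continuous (by fun_prop)
  have i3 : Integrable (fun θ => 2 * ⟪p θ, f θ⟫_ℝ) (haarAddCircle (T := 1)) :=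
    UnitAddCircle.integrable_of_continuous (continuous_const.mul (hpc.inner hf))
  have h2 : ∫ θ, ‖f θ - p θ‖ ^ 2 ∂haarAddCircle = ∫ θ, ‖f θ‖ ^ 2 ∂haarAddCircle
      - ∫ θ, 2 * ⟪p θ, f θ⟫_ℝ ∂haarAddCircle + ∫ θ, ‖p θ‖ ^ 2 ∂haarAddCircle := by
    have i4 : Integrable (fun θ => ‖f θ‖ ^ 2 - 2 * ⟪p θ, f θ⟫_ℝ) (haarAddCircle (T := 1)) :=
      i1.sub i3
    rw [← integral_sub i1 i3, ← integral_add i4 i2]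
    refine integral_congr_ae (Filter.Eventually.of_forall fun θ => ?_)
    simp only []
    rw [norm_sub_sq_real, real_inner_comm]
  rw [integral_const_mul] at h2
  linarith

end TrigPoly

section Galerkin

open scoped InnerProductSpace
open MeasureTheory AddCircle

attribute [local instance] InnerProductSpace.complexToReal

variable {E : Type*} [NormedAddCommGroup E] [InnerProductSpace ℂ E]

local instance (K : Finset ℤ) : InnerProductSpace ℝ (PiLp 2 fun _ : K => E) :=
  PiLp.innerProductSpace fun _ : K => E

/-- The derivative of trigonometric polynomials, divided by the imaginary unit, on coefficients. -/
def fourierMultiplier (E : Type*) [NormedAddCommGroup E] [InnerProductSpace ℂ E]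
    [FiniteDimensional ℂ E] (K : Finset ℤ) :
    (PiLp 2 fun _ : K => E) →L[ℝ] (PiLp 2 fun _ : K => E) :=
  LinearMap.toContinuousLinearMap
    { toFun := fun a => WithLp.toLp 2 fun k => (2 * π * (k : ℤ) : ℝ) • a k
      map_add' := fun a b => by ext k; simp
      map_smul' := fun c a => by ext k; simp [smul_comm c] }

theorem fourierMultiplier_apply [FiniteDimensional ℂ E] (K : Finset ℤ)
    (a : PiLp 2 fun _ : K => E) (k : K) :
    fourierMultiplier E K a k = (2 * π * (k : ℤ) : ℝ) • a k := rfl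

theorem inner_fourierMultiplier [FiniteDimensional ℂ E] (K : Finset ℤ)
    (a b : PiLp 2 fun _ : K => E) :
    ⟪fourierMultiplier E K a, b⟫_ℝ = ∑ k : K, 2 * π * (k : ℤ) * ⟪a k, b k⟫_ℝ := by
  rw [PiLp.inner_apply]
  refine Finset.sum_congr rfl fun k _ => ?_
  rw [fourierMultiplier_apply, real_inner_smul_left]

theorem trigPoly_sub (K : Finset ℤ) (a b : K → E) (θ : UnitAddCircle) :
    trigPoly K (a - b) θ = trigPoly K a θ - trigPoly K b θ := by
  simp [trigPoly, smul_sub]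

theorem trigPoly_smul (K : Finset ℤ) (c : ℝ) (a : K → E) (θ : UnitAddCircle) :
    trigPoly K (c • a) θ = c • trigPoly K a θ := by
  simp [trigPoly, Finset.smul_sum, smul_comm c]

theorem continuous_trigPoly_uncurry [FiniteDimensional ℂ E] (K : Finset ℤ) :
    Continuous fun p : (PiLp 2 fun _ : K => E) × UnitAddCircle => trigPoly K p.1.ofLp p.2 := by
  unfold trigPoly
  fun_prop

variable {H : E → ℝ} {G : E → E} {C K : ℝ}

theorem integral_norm_sq_eq (N : Finset ℤ) [FiniteDimensional ℂ E] (a : PiLp 2 fun _ : N => E) :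
    ∫ θ, ‖trigPoly N a.ofLp θ‖ ^ 2 ∂haarAddCircle = ‖a‖ ^ 2 := by
  have : CompleteSpace E := FiniteDimensional.complete ℂ E
  rw [integral_norm_sq_trigPoly, PiLp.norm_sq_eq_of_L2]

theorem integrable_norm_sq_trigPoly (N : Finset ℤ) (a : N → E) :
    Integrable (fun θ => ‖trigPoly N a θ‖ ^ 2) haarAddCircle :=
  UnitAddCircle.integrable_of_continuous ((continuous_trigPoly N a).norm.pow 2)

theorem exists_galerkin_solution [FiniteDimensional ℂ E] [Nontrivial E]
    (h : IsQuadraticHamiltonian H G C K) (n : ℕ) :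
    ∃ (a : PiLp 2 fun _ : Finset.Icc (-(n + 1 : ℤ)) (n + 1) => E) (T : ℝ),
      ∫ θ, H (trigPoly _ a.ofLp θ) ∂haarAddCircle = 1 ∧ 2 * π / K ≤ T ∧ T ≤ π ∧
      ∀ k : Finset.Icc (-(n + 1 : ℤ)) (n + 1),
        (2 * π * (k : ℤ) : ℝ) • a k
          = T • fourierCoeff (fun θ => G (trigPoly _ a.ofLp θ)) k := by
  have : CompleteSpace E := FiniteDimensional.complete ℂ E
  have hK := h.two_le
  set N := Finset.Icc (-(n + 1 : ℤ)) (n + 1) with hN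
  let V := PiLp 2 fun _ : N => E
  have hGc : ∀ a : N → E, Continuous fun θ => G (trigPoly N a θ) := fun a =>
    h.continuous_gradient.comp (continuous_trigPoly N a)
  have hHi : ∀ a : N → E, Integrable (fun θ => H (trigPoly N a θ)) haarAddCircle := fun a =>
    UnitAddCircle.integrable_of_continuous (h.continuous.comp (continuous_trigPoly N a))
  let hh : V → ℝ := fun a => ∫ θ, H (trigPoly N a.ofLp θ) ∂haarAddCircle
  let F : V → V := fun a => WithLp.toLp 2 fun k => fourierCoeff (fun θ => G (trigPoly N a.ofLp θ)) k
  have hFinner : ∀ a b : V, ⟪F a, b⟫_ℝ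
      = ∫ θ, ⟪G (trigPoly N a.ofLp θ), trigPoly N b.ofLp θ⟫_ℝ ∂haarAddCircle := by
    intro a b
    have := integral_inner_trigPoly N b.ofLp (hGc a.ofLp)
    rw [PiLp.inner_apply]
    simp_rw [real_inner_comm (trigPoly N b.ofLp _), this, real_inner_comm (b.ofLp _)]
    rfl
  have hF : Continuous F := by
    refine (PiLp.continuous_toLp 2 _).comp (continuous_pi fun k => ?_)
    have := continuous_parametric_integral_of_continuous (μ := haarAddCircle (T := 1))
      (f := fun (a : V) θ => fourier (-(k : ℤ)) θ • G (trigPoly N a.ofLp θ))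
      (((map_continuous (fourier (-(k : ℤ)))).comp continuous_snd).smul
        (h.continuous_gradient.comp (continuous_trigPoly_uncurry N))) isCompact_univ
    simpa [fourierCoeff] using this
  have hL : ∀ x y : V, ⟪fourierMultiplier E N x, y⟫_ℝ = ⟪x, fourierMultiplier E N y⟫_ℝ := by
    intro x y
    rw [inner_fourierMultiplier, real_inner_comm, inner_fourierMultiplier]
    exact Finset.sum_congr rfl fun k _ => by rw [real_inner_comm]
  have hLself : ∀ x : V, ⟪fourierMultiplier E N x, x⟫_ℝ = ∑ k : N, 2 * π * (k : ℤ) * ‖x k‖ ^ 2 := by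
    intro x
    rw [inner_fourierMultiplier]
    simp only [real_inner_self_eq_norm_sq]
  have hrem : ∀ u v : V, |hh v - hh u - ⟪F u, v - u⟫_ℝ| ≤ C * ‖v - u‖ ^ 2 := by
    intro u v
    have i1 : Integrable (fun θ => H (trigPoly N v.ofLp θ) - H (trigPoly N u.ofLp θ))
      haarAddCircle := (hHi v.ofLp).sub (hHi u.ofLp)
    have i2 : Integrable (fun θ => ⟪G (trigPoly N u.ofLp θ), trigPoly N (v - u).ofLp θ⟫_ℝ)
      haarAddCircle := UnitAddCircle.integrable_of_continuous
        ((hGc u.ofLp).inner (continuous_trigPoly N _))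
    rw [hFinner, ← integral_norm_sq_eq, ← integral_const_mul,
      ← integral_sub (hHi v.ofLp) (hHi u.ofLp), ← integral_sub i1 i2, ← Real.norm_eq_abs]
    refine norm_integral_le_of_norm_le ((integrable_norm_sq_trigPoly N _).const_mul C)
      (Filter.Eventually.of_forall fun θ => ?_)
    rw [WithLp.ofLp_sub, trigPoly_sub]
    exact h.remainder _ _
  have hhom : ∀ (c : ℝ) (u : V), 0 ≤ c → hh (c • u) = c ^ 2 * hh u := by
    intro c u hc
    simp only [hh]
    rw [← integral_const_mul]
    refine integral_congr_ae (Filter.Eventually.of_forall fun θ => ?_)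
    change H (trigPoly N (c • u.ofLp) θ) = c ^ 2 * H (trigPoly N u.ofLp θ)
    rw [trigPoly_smul]
    exact h.homogeneous c _ hc
  have hFhom : ∀ (c : ℝ) (u : V), 0 ≤ c → F (c • u) = c • F u := by
    intro c u hc
    ext k
    change fourierCoeff (fun θ => G (trigPoly N (c • u.ofLp) θ)) k
      = c • fourierCoeff (fun θ => G (trigPoly N u.ofLp θ)) k
    simp only [fourierCoeff, trigPoly_smul]
    rw [← integral_smul]
    refine integral_congr_ae (Filter.Eventually.of_forall fun θ => ?_)
    simp only [h.gradient_homogeneous c _ hc]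
    rw [smul_comm]
  have hEuler : ∀ u : V, ⟪F u, u⟫_ℝ = 2 * hh u := by
    intro u
    rw [hFinner, ← integral_const_mul]
    exact integral_congr_ae (Filter.Eventually.of_forall fun θ => h.euler _)
  have hlow : ∀ u : V, ‖u‖ ^ 2 ≤ hh u := by
    intro u
    rw [← integral_norm_sq_eq]
    exact integral_mono (integrable_norm_sq_trigPoly N _) (hHi _) fun θ => h.norm_sq_le _
  have hup : ∀ u : V, hh u ≤ K / 2 * ‖u‖ ^ 2 := by
    intro u
    rw [← integral_norm_sq_eq, ← integral_const_mul]
    exact integral_mono (hHi _) ((integrable_norm_sq_trigPoly N _).const_mul _)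
      fun θ => h.le_mul_norm_sq _
  let W : Submodule ℝ V :=
    { carrier := {a | ∀ k : N, 0 < (k : ℤ) → a k = 0}
      add_mem' := fun {a b} ha hb k hk => by
        change a k + b k = 0
        rw [ha k hk, hb k hk, add_zero]
      zero_mem' := fun k _ => rfl
      smul_mem' := fun c a ha k hk => by
        change c • a k = 0
        rw [ha k hk, smul_zero] }
  obtain ⟨e₀, he₀⟩ := exists_ne (0 : E)
  let k₁ : N := ⟨1, by rw [hN, Finset.mem_Icc]; omega⟩
  let e : V := WithLp.toLp 2 (Pi.single k₁ e₀)
  have he' : ∀ k : N, k ≠ k₁ → e k = 0 := fun k hk => Pi.single_eq_of_ne hk _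
  have he1 : e k₁ = e₀ := Pi.single_eq_same (M := fun _ : N => E) k₁ e₀
  have heW : e ∈ Wᗮ := by
    rw [Submodule.mem_orthogonal]
    intro w hw
    rw [PiLp.inner_apply]
    refine Finset.sum_eq_zero fun k _ => ?_
    by_cases hk : k = k₁
    · rw [hw k (by rw [hk]; exact one_pos), inner_zero_left]
    · rw [he' k hk, inner_zero_right]
  have he : e ≠ 0 := by
    intro h0
    rw [h0] at he1
    exact he₀ he1.symm
  have hW : ∀ w ∈ W, ⟪fourierMultiplier E N w, w⟫_ℝ ≤ 0 := by
    intro w hw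
    rw [hLself]
    refine Finset.sum_nonpos fun k _ => ?_
    by_cases hk : 0 < (k : ℤ)
    · rw [hw k hk]; simp
    · have h1 : ((k : ℤ) : ℝ) ≤ 0 := by exact_mod_cast not_lt.1 hk
      have h2 : 0 ≤ π * ‖w k‖ ^ 2 := by positivity
      nlinarith
  have hWperp : ∀ w ∈ Wᗮ, 2 * π / K * hh w ≤ 1 / 2 * ⟪fourierMultiplier E N w, w⟫_ℝ := by
    intro w hw
    have hw0 : ∀ k : N, (k : ℤ) ≤ 0 → w k = 0 := by
      intro k hk
      have hmem : (WithLp.toLp 2 (Pi.single k (w k)) : V) ∈ W := by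
        intro j hj
        refine Pi.single_eq_of_ne (fun hjk => ?_) _
        rw [hjk] at hj
        exact absurd hk (not_le.2 hj)
      have h1 := (Submodule.mem_orthogonal _ _).1 hw _ hmem
      rw [PiLp.inner_apply, Finset.sum_eq_single k] at h1
      · simpa using h1
      · intro j _ hj
        simp [Pi.single_eq_of_ne hj]
      · intro hk'
        exact absurd (Finset.mem_univ k) hk'
    have h1 : 2 * π / K * hh w ≤ π * ‖w‖ ^ 2 := by
      calc 2 * π / K * hh w ≤ 2 * π / K * (K / 2 * ‖w‖ ^ 2) :=
            mul_le_mul_of_nonneg_left (hup w) (by positivity)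
        _ = π * ‖w‖ ^ 2 := by field_simp
    refine h1.trans ?_
    rw [hLself, PiLp.norm_sq_eq_of_L2, Finset.mul_sum, Finset.mul_sum]
    refine Finset.sum_le_sum fun k _ => ?_
    by_cases hk : (k : ℤ) ≤ 0
    · rw [hw0 k hk]; simp
    · have h1 : (1 : ℝ) ≤ ((k : ℤ) : ℝ) := by exact_mod_cast not_le.1 hk
      have h2 : 0 ≤ π * ‖w k‖ ^ 2 := by positivity
      nlinarith
  have hWe : ∀ w ∈ W, ∀ s : ℝ, 1 / 2 * ⟪fourierMultiplier E N (w + s • e), w + s • e⟫_ℝ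
      ≤ π * hh (w + s • e) := by
    intro w hw s
    refine le_trans ?_ (mul_le_mul_of_nonneg_left (hlow _) pi_pos.le)
    rw [hLself, PiLp.norm_sq_eq_of_L2, Finset.mul_sum, Finset.mul_sum]
    refine Finset.sum_le_sum fun k _ => ?_
    have h2 : 0 ≤ π * ‖(w + s • e) k‖ ^ 2 := by positivity
    by_cases hk : (k : ℤ) ≤ 1
    · have h1 : ((k : ℤ) : ℝ) ≤ 1 := by exact_mod_cast hk
      nlinarith
    · have hk1 : k ≠ k₁ := fun h' => hk (by rw [h'])
      have h0 : (w + s • e) k = 0 := by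
        rw [PiLp.add_apply, PiLp.smul_apply, hw k (by omega), he' k hk1]
        simp
      rw [h0]; simp
  obtain ⟨a, T, h1, h2, h3, h4⟩ := exists_nonlinear_eigenvector (V := V) (fourierMultiplier E N)
    hL hh F hF C hrem hhom hFhom hEuler hlow W e heW he (2 * π / K) π (by positivity) hW hWperp hWe
  refine ⟨a, T, h1, h2, h3, fun k => ?_⟩
  have := congrArg (fun b : V => b k) h4
  exact this

end Galerkin

section WeakLimit

open scoped InnerProductSpace
open MeasureTheory AddCircle Filter

attribute [local instance] InnerProductSpace.complexToReal

variable {E : Type*} [NormedAddCommGroup E] [InnerProductSpace ℂ E]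
  {H : E → ℝ} {G : E → E} {C K : ℝ}

theorem summable_one_div_one_add_int_sq : Summable fun k : ℤ => 1 / (1 + (k : ℝ) ^ 2) := by
  have h1 : Summable fun k : ℤ => 1 / (k : ℝ) ^ 2 + if k = 0 then (1 : ℝ) else 0 :=
    (Real.summable_one_div_int_pow.2 one_lt_two).add
      (summable_of_hasFiniteSupport ((Set.finite_singleton (0 : ℤ)).subset fun k hk => by
        by_contra h
        simp_all))
  refine Summable.of_nonneg_of_le (fun k => by positivity) (fun k => ?_) h1
  by_cases hk : k = 0
  · simp [hk]
  · have : (0 : ℝ) < (k : ℝ) ^ 2 := by positivity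
    simp only [hk, if_false, add_zero]
    exact one_div_le_one_div_of_le this (by linarith)

theorem norm_sq_sum_smul_le (N : Finset ℤ) (a : N → E) (c : ℤ → ℂ) (hc : ∀ k, ‖c k‖ ≤ 2) :
    ‖∑ k : N, c k • a k‖ ^ 2 ≤ (∑ k : N, (1 + ((k : ℤ) : ℝ) ^ 2) * ‖a k‖ ^ 2) *
      ∑' k : ℤ, ‖c k‖ ^ 2 * (1 / (1 + (k : ℝ) ^ 2)) := by
  have h1 : ‖∑ k : N, c k • a k‖ ≤ ∑ k : N, ‖c k‖ * ‖a k‖ :=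
    (norm_sum_le _ _).trans_eq (Finset.sum_congr rfl fun k _ => norm_smul _ _)
  have h2 : (∑ k : N, ‖c k‖ * ‖a k‖) ^ 2 ≤
      (∑ k : N, (1 + ((k : ℤ) : ℝ) ^ 2) * ‖a k‖ ^ 2) *
        ∑ k : N, ‖c k‖ ^ 2 * (1 / (1 + ((k : ℤ) : ℝ) ^ 2)) := by
    refine Finset.sum_sq_le_sum_mul_sum_of_sq_le_mul _ (fun k _ => by positivity)
      (fun k _ => by positivity) fun k _ => le_of_eq ?_
    field_simp
  have h3 : ∑ k : N, ‖c k‖ ^ 2 * (1 / (1 + ((k : ℤ) : ℝ) ^ 2))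
      ≤ ∑' k : ℤ, ‖c k‖ ^ 2 * (1 / (1 + (k : ℝ) ^ 2)) := by
    have hs : Summable fun k : ℤ => ‖c k‖ ^ 2 * (1 / (1 + (k : ℝ) ^ 2)) := by
      refine Summable.of_nonneg_of_le (fun k => by positivity) (fun k => ?_)
        (summable_one_div_one_add_int_sq.mul_left (2 ^ 2))
      exact mul_le_mul_of_nonneg_right (pow_le_pow_left₀ (norm_nonneg _) (hc k) 2) (by positivity)
    rw [Finset.sum_coe_sort N fun k : ℤ => ‖c k‖ ^ 2 * (1 / (1 + (k : ℝ) ^ 2))]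
    exact hs.sum_le_tsum N fun k _ => by positivity
  calc ‖∑ k : N, c k • a k‖ ^ 2 ≤ (∑ k : N, ‖c k‖ * ‖a k‖) ^ 2 :=
        pow_le_pow_left₀ (norm_nonneg _) h1 2
    _ ≤ _ := h2
    _ ≤ _ := mul_le_mul_of_nonneg_left h3 (Finset.sum_nonneg fun k _ => by positivity)

/-- The modulus of continuity of the embedding of `H¹` of the circle in continuous functions. -/
def circleModulus (θ φ : UnitAddCircle) : ℝ :=
  ∑' k : ℤ, ‖fourier k θ - fourier k φ‖ ^ 2 * (1 / (1 + (k : ℝ) ^ 2))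

theorem norm_fourier_apply (k : ℤ) (θ : UnitAddCircle) : ‖fourier k θ‖ = 1 := by
  rw [fourier_apply]; exact Circle.norm_coe _

theorem norm_fourier_sub_le (k : ℤ) (θ φ : UnitAddCircle) : ‖fourier k θ - fourier k φ‖ ≤ 2 := by
  refine (norm_sub_le _ _).trans ?_
  rw [norm_fourier_apply, norm_fourier_apply]; norm_num

theorem continuous_circleModulus :
    Continuous fun p : UnitAddCircle × UnitAddCircle => circleModulus p.1 p.2 := by
  unfold circleModulus
  refine continuous_tsum (u := fun k : ℤ => 2 ^ 2 * (1 / (1 + (k : ℝ) ^ 2))) (fun k => by fun_prop)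
    (summable_one_div_one_add_int_sq.mul_left (2 ^ 2)) fun k p => ?_
  rw [Real.norm_of_nonneg (by positivity)]
  exact mul_le_mul_of_nonneg_right
    (pow_le_pow_left₀ (norm_nonneg _) (norm_fourier_sub_le _ _ _) 2) (by positivity)

theorem circleModulus_self (θ : UnitAddCircle) : circleModulus θ θ = 0 := by
  simp [circleModulus]

theorem norm_sq_trigPoly_sub_le (N : Finset ℤ) (a : N → E) (θ φ : UnitAddCircle) :
    ‖trigPoly N a θ - trigPoly N a φ‖ ^ 2 ≤
      (∑ k : N, (1 + ((k : ℤ) : ℝ) ^ 2) * ‖a k‖ ^ 2) * circleModulus θ φ := by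
  have := norm_sq_sum_smul_le N a (fun k => fourier k θ - fourier k φ) fun k =>
    norm_fourier_sub_le k θ φ
  rw [trigPoly, trigPoly, ← Finset.sum_sub_distrib]
  simp only [← sub_smul]
  exact this

theorem norm_sq_trigPoly_le (N : Finset ℤ) (a : N → E) (θ : UnitAddCircle) :
    ‖trigPoly N a θ‖ ^ 2 ≤ (∑ k : N, (1 + ((k : ℤ) : ℝ) ^ 2) * ‖a k‖ ^ 2) *
      ∑' k : ℤ, 1 / (1 + (k : ℝ) ^ 2) := by
  have := norm_sq_sum_smul_le N a (fun k => fourier k θ) fun k => by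
    rw [norm_fourier_apply]; norm_num
  simp only [norm_fourier_apply, one_pow, one_mul] at this
  exact this

/-- A Galerkin approximation together with its uniform Sobolev bound. -/
theorem exists_galerkin_solution_bounded [FiniteDimensional ℂ E] [Nontrivial E]
    (h : IsQuadraticHamiltonian H G C K) (n : ℕ) :
    ∃ (a : (Finset.Icc (-(n + 1 : ℤ)) (n + 1)) → E) (T : ℝ),
      ∫ θ, H (trigPoly _ a θ) ∂haarAddCircle = 1 ∧ 2 * π / K ≤ T ∧ T ≤ π ∧
      (∀ k : Finset.Icc (-(n + 1 : ℤ)) (n + 1), (2 * π * (k : ℤ) : ℝ) •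
        fourierCoeff (trigPoly _ a) k = T • fourierCoeff (fun θ => G (trigPoly _ a θ)) k) ∧
      ∑ k : Finset.Icc (-(n + 1 : ℤ)) (n + 1), (1 + ((k : ℤ) : ℝ) ^ 2) * ‖a k‖ ^ 2
        ≤ 1 + K ^ 2 / 4 := by
  have : CompleteSpace E := FiniteDimensional.complete ℂ E
  have hK := h.two_le
  obtain ⟨a, T, h1, h2, h3, h4⟩ := exists_galerkin_solution h n
  generalize Finset.Icc (-(n + 1 : ℤ)) (n + 1) = N at *
  have hT : 0 < T := lt_of_lt_of_le (by positivity) h2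
  have hGc : Continuous fun θ => G (trigPoly N a.ofLp θ) :=
    h.continuous_gradient.comp (continuous_trigPoly N _)
  have hHi : Integrable (fun θ => H (trigPoly N a.ofLp θ)) haarAddCircle :=
    UnitAddCircle.integrable_of_continuous (h.continuous.comp (continuous_trigPoly N _))
  have hb1 : ∫ θ, ‖trigPoly N a.ofLp θ‖ ^ 2 ∂haarAddCircle ≤ 1 := by
    exact (integral_mono (integrable_norm_sq_trigPoly N _) hHi fun θ => h.norm_sq_le _).trans_eq h1
  have hb2 : ∑ k : N, ‖fourierCoeff (fun θ => G (trigPoly N a.ofLp θ)) k‖ ^ 2 ≤ K ^ 2 := by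
    refine (sum_norm_sq_fourierCoeff_le N hGc).trans ?_
    calc ∫ θ, ‖G (trigPoly N a.ofLp θ)‖ ^ 2 ∂haarAddCircle
        ≤ ∫ θ, K ^ 2 * ‖trigPoly N a.ofLp θ‖ ^ 2 ∂haarAddCircle := by
          refine integral_mono (UnitAddCircle.integrable_of_continuous (hGc.norm.pow 2))
            ((integrable_norm_sq_trigPoly N _).const_mul _) fun θ => ?_
          simp only [← mul_pow]
          exact pow_le_pow_left₀ (norm_nonneg _) (h.gradient_le _) 2
      _ = K ^ 2 * ∫ θ, ‖trigPoly N a.ofLp θ‖ ^ 2 ∂haarAddCircle := integral_const_mul _ _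
      _ ≤ K ^ 2 * 1 := mul_le_mul_of_nonneg_left hb1 (by positivity)
      _ = K ^ 2 := mul_one _
  refine ⟨a.ofLp, T, h1, h2, h3, fun k => ?_, ?_⟩
  · rw [fourierCoeff_trigPoly]; exact h4 k
  · have hk : ∀ k : N, (1 + ((k : ℤ) : ℝ) ^ 2) * ‖a k‖ ^ 2 ≤ ‖a k‖ ^ 2
        + 1 / 4 * ‖fourierCoeff (fun θ => G (trigPoly N a.ofLp θ)) k‖ ^ 2 := by
      intro k
      have h5 := congrArg (fun v => ‖v‖ ^ 2) (h4 k)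
      simp only [norm_smul, mul_pow, Real.norm_eq_abs, sq_abs] at h5
      have h6 : T ^ 2 ≤ π ^ 2 := pow_le_pow_left₀ hT.le h3 2
      have h7 := mul_le_mul_of_nonneg_right h6
        (sq_nonneg ‖fourierCoeff (fun θ => G (trigPoly N a.ofLp θ)) k‖)
      rw [← h5] at h7
      have h8 : π ^ 2 * (4 * (((k : ℤ) : ℝ) ^ 2 * ‖a k‖ ^ 2)) ≤ π ^ 2 *
          ‖fourierCoeff (fun θ => G (trigPoly N a.ofLp θ)) k‖ ^ 2 := by linarith
      have h9 := le_of_mul_le_mul_left h8 (by positivity)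
      linarith
    refine (Finset.sum_le_sum fun k _ => hk k).trans ?_
    rw [Finset.sum_add_distrib, ← Finset.mul_sum, ← integral_norm_sq_trigPoly]
    linarith

theorem tendsto_fourierCoeff_of_bounded {f : ℕ → UnitAddCircle → E} {f₀ : UnitAddCircle → E}
    (hf : ∀ n, Continuous (f n)) {B : ℝ} (hB : ∀ n θ, ‖f n θ‖ ≤ B)
    (hlim : ∀ θ, Tendsto (fun n => f n θ) atTop (nhds (f₀ θ))) (k : ℤ) :
    Tendsto (fun n => fourierCoeff (f n) k) atTop (nhds (fourierCoeff f₀ k)) := by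
  refine tendsto_integral_of_dominated_convergence (fun _ => B) (fun n => ?_)
    (integrable_const B) (fun n => Eventually.of_forall fun θ => ?_)
    (Eventually.of_forall fun θ => (hlim θ).const_smul _)
  · have := hf n
    exact (UnitAddCircle.integrable_of_continuous
      (f := fun θ => fourier (-k) θ • f n θ) (by fun_prop)).aestronglyMeasurable
  · rw [norm_smul, norm_fourier_apply, one_mul]
    exact hB n θ

theorem exists_subseq_tendsto_of_modulus {X : Type*} [TopologicalSpace X] [CompactSpace X]
    {F : Type*} [NormedAddCommGroup F] [ProperSpace F] (f : ℕ → X → F)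
    (hf : ∀ n, Continuous (f n)) {R : ℝ} (hR : ∀ n θ, ‖f n θ‖ ≤ R) (b : X → X → ℝ)
    (hb : ∀ θ, Tendsto (b θ) (nhds θ) (nhds 0)) (hfb : ∀ n θ φ, dist (f n θ) (f n φ) ≤ b θ φ)
    {m M : ℝ} (T : ℕ → ℝ) (hT : ∀ n, T n ∈ Set.Icc m M) :
    ∃ (x : X → F) (T₀ : ℝ) (φ : ℕ → ℕ), Continuous x ∧ T₀ ∈ Set.Icc m M ∧ StrictMono φ ∧
      (∀ θ, Tendsto (fun n => f (φ n) θ) atTop (nhds (x θ))) ∧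
      Tendsto (fun n => T (φ n)) atTop (nhds T₀) := by
  let g : ℕ → BoundedContinuousFunction X F := fun n =>
    BoundedContinuousFunction.mkOfCompact ⟨f n, hf n⟩
  have hcpt : IsCompact (closure (Set.range g)) := by
    refine BoundedContinuousFunction.arzela_ascoli (Metric.closedBall 0 R)
      (isCompact_closedBall 0 R) _ ?_ fun θ => ?_
    · rintro _ θ ⟨n, rfl⟩
      exact mem_closedBall_zero_iff.2 (hR n θ)
    · refine Metric.equicontinuousAt_of_continuity_modulus (b θ) (hb θ) _
        (Eventually.of_forall fun φ => ?_)
      rintro ⟨_, n, rfl⟩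
      exact hfb n θ φ
  obtain ⟨p, hp, φ, hφ, hlim⟩ := (hcpt.prod (isCompact_Icc (a := m) (b := M))).tendsto_subseq
    (x := fun n => (g n, T n)) fun n => ⟨subset_closure ⟨n, rfl⟩, hT n⟩
  refine ⟨p.1, p.2, φ, p.1.continuous, hp.2, hφ, fun θ => ?_,
    (continuous_snd.tendsto _).comp hlim⟩
  exact ((continuous_eval_const θ).tendsto p.1).comp
    ((continuous_fst.tendsto _).comp hlim)

theorem exists_weak_periodic_solution [FiniteDimensional ℂ E] [Nontrivial E]
    (h : IsQuadraticHamiltonian H G C K) :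
    ∃ (x : UnitAddCircle → E) (T : ℝ), Continuous x ∧ 0 < T ∧ T ≤ π ∧
      ∫ θ, H (x θ) ∂haarAddCircle = 1 ∧
      ∀ k : ℤ, (2 * π * k : ℝ) • fourierCoeff x k = T • fourierCoeff (fun θ => G (x θ)) k := by
  have : CompleteSpace E := FiniteDimensional.complete ℂ E
  have : ProperSpace E := FiniteDimensional.proper ℂ E
  have hK := h.two_le
  choose a T h1 h2 h3 h4 h5 using exists_galerkin_solution_bounded h
  set B : ℝ := 1 + K ^ 2 / 4 with hB
  have hB0 : 0 < B := by positivity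
  set R : ℝ := √(B * ∑' k : ℤ, 1 / (1 + (k : ℝ) ^ 2)) with hR
  obtain ⟨f, hf⟩ : ∃ f : ℕ → UnitAddCircle → E, ∀ n, f n = trigPoly _ (a n) := ⟨_, fun _ => rfl⟩
  have hfc : ∀ n, Continuous (f n) := fun n => by rw [hf]; exact continuous_trigPoly _ _
  simp only [← hf] at h1 h4
  have hfR : ∀ n θ, ‖f n θ‖ ≤ R := by
    intro n θ
    rw [hf]
    refine Real.le_sqrt_of_sq_le ((norm_sq_trigPoly_le _ _ θ).trans ?_)
    exact mul_le_mul_of_nonneg_right (h5 n) (tsum_nonneg fun k => by positivity)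
  obtain ⟨x, T₀, φ, hxc, hT₀, hφ, hlp, hlT⟩ := exists_subseq_tendsto_of_modulus f hfc hfR
    (fun θ φ => √(B * circleModulus θ φ)) (fun θ => by
      have hc : Continuous fun φ => √(B * circleModulus θ φ) := (continuous_const.mul
        (continuous_circleModulus.comp (by fun_prop : Continuous fun φ => (θ, φ)))).sqrt
      simpa [circleModulus_self] using hc.tendsto θ) (fun n θ φ => by
      rw [hf, dist_eq_norm]
      refine Real.le_sqrt_of_sq_le ((norm_sq_trigPoly_sub_le _ _ θ φ).trans ?_)
      exact mul_le_mul_of_nonneg_right (h5 n) (tsum_nonneg fun k => by positivity))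
    T fun n => ⟨h2 n, h3 n⟩
  refine ⟨x, T₀, hxc, lt_of_lt_of_le (by positivity) hT₀.1, hT₀.2, ?_, fun k => ?_⟩
  · have h6 : Tendsto (fun n => ∫ θ, H (f (φ n) θ) ∂haarAddCircle) atTop
        (nhds (∫ θ, H (x θ) ∂haarAddCircle)) := by
      refine tendsto_integral_of_dominated_convergence (fun _ => K / 2 * R ^ 2) (fun n => ?_)
        (integrable_const _) (fun n => Eventually.of_forall fun θ => ?_)
        (Eventually.of_forall fun θ => (h.continuous.tendsto _).comp (hlp θ))
      · exact (UnitAddCircle.integrable_of_continuous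
          (h.continuous.comp (hfc (φ n)))).aestronglyMeasurable
      · rw [Real.norm_of_nonneg ((sq_nonneg _).trans (h.norm_sq_le _))]
        refine (h.le_mul_norm_sq _).trans (mul_le_mul_of_nonneg_left ?_ (by positivity))
        exact pow_le_pow_left₀ (norm_nonneg _) (hfR _ _) 2
    refine tendsto_nhds_unique h6 (tendsto_const_nhds.congr fun n => ?_)
    exact (h1 (φ n)).symm
  · have h6 := (tendsto_fourierCoeff_of_bounded (fun n => (hfc (φ n)))
      (fun n θ => hfR (φ n) θ) hlp k).const_smul (2 * π * k : ℝ)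
    have h7 := hlT.smul (tendsto_fourierCoeff_of_bounded
      (f := fun n θ => G (f (φ n) θ)) (f₀ := fun θ => G (x θ)) (B := K * R)
      (fun n => h.continuous_gradient.comp (hfc (φ n)))
      (fun n θ => (h.gradient_le _).trans (mul_le_mul_of_nonneg_left (hfR (φ n) θ) (by positivity)))
      (fun θ => (h.continuous_gradient.tendsto _).comp (hlp θ)) k)
    refine tendsto_nhds_unique_of_eventuallyEq h6 h7 ?_
    filter_upwards [eventually_ge_atTop k.natAbs] with n hn
    have hn' := hn.trans hφ.le_apply
    exact h4 (φ n) ⟨k, by rw [Finset.mem_Icc]; omega⟩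

end WeakLimit

section StrongSolution

open scoped InnerProductSpace
open MeasureTheory AddCircle Filter

theorem fourierCoeff_eq_fourierCoeffOn_zero_one {F : Type*} [NormedAddCommGroup F]
    [NormedSpace ℂ F] (f : UnitAddCircle → F) (k : ℤ) :
    fourierCoeff f k = fourierCoeffOn zero_lt_one (fun t : ℝ => f t) k := by
  rw [fourierCoeffOn_eq_integral, fourierCoeff_eq_intervalIntegral f k 0]
  simp

/-- A continuous function on the circle whose Fourier coefficients are those of an antiderivative
of `g` is differentiable with derivative `g`. -/
theorem UnitAddCircle.hasDerivAt_of_fourierCoeff_complex {f g : UnitAddCircle → ℂ}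
    (hf : Continuous f)
    (hg : Continuous g) (h : ∀ k : ℤ, 2 * π * Complex.I * k * fourierCoeff f k = fourierCoeff g k)
    (t : ℝ) : HasDerivAt (fun s : ℝ => f s) (g t) t := by
  have hgc : Continuous fun s : ℝ => g s := hg.comp (AddCircle.continuous_mk' 1)
  have hfc : Continuous fun s : ℝ => f s := hf.comp (AddCircle.continuous_mk' 1)
  set y : ℝ → ℂ := fun t => ∫ s in (0 : ℝ)..t, g s with hy
  have hyd : ∀ t : ℝ, HasDerivAt y (g t) t := fun t =>
    intervalIntegral.integral_hasDerivAt_right (hgc.intervalIntegrable _ _)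
      (hgc.stronglyMeasurableAtFilter _ _) hgc.continuousAt
  have hg0 : ∫ s in (0 : ℝ)..1, g s = 0 := by
    have h0 := h 0
    rw [fourierCoeff_eq_intervalIntegral g 0 0] at h0
    simpa using h0.symm
  have hgp : Function.Periodic (fun s : ℝ => g s) 1 := fun s => by
    simp
  have hyp : Function.Periodic y 1 := fun t => by
    rw [hy]
    simp only
    rw [← intervalIntegral.integral_add_adjacent_intervals (hgc.intervalIntegrable 0 t)
      (hgc.intervalIntegrable t (t + 1)), hgp.intervalIntegral_add_eq t 0, zero_add, hg0, add_zero]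
  have hyc : Continuous y := continuous_iff_continuousAt.2 fun t => (hyd t).continuousAt
  set Y : UnitAddCircle → ℂ := hyp.lift with hY
  have hYt : ∀ t : ℝ, Y t = y t := fun t => hyp.lift_coe t
  have hYc : Continuous Y := by
    refine continuous_quot_lift _ hyc
  have hcoef : ∀ k : ℤ, k ≠ 0 → fourierCoeff (fun θ => f θ - Y θ) k = 0 := by
    intro k hk
    have h1 : fourierCoeff Y k = 1 / (2 * π * Complex.I * k) * fourierCoeff g k := by
      rw [fourierCoeff_eq_fourierCoeffOn_zero_one, fourierCoeff_eq_fourierCoeffOn_zero_one g]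
      have := fourierCoeffOn_of_hasDerivAt (zero_lt_one (α := ℝ)) hk (f := fun t : ℝ => Y t)
        (f' := fun t : ℝ => g t) (fun t _ => by simpa only [hYt] using hyd t)
        (hgc.intervalIntegrable _ _)
      rw [this]
      have h01 : y 1 = y 0 := by simpa using hyp 0
      rw [hYt, hYt, h01]
      have : (2 * π * Complex.I * k) ≠ 0 := by
        simp [Complex.I_ne_zero, hk, Real.pi_ne_zero]
      simp only [sub_self, mul_zero, Complex.ofReal_one, Complex.ofReal_zero, sub_zero, one_mul,
        zero_sub]
      field_simp
    have h2 : fourierCoeff (fun θ => f θ - Y θ) k = fourierCoeff f k - fourierCoeff Y k := by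
      simp only [fourierCoeff, smul_sub]
      exact integral_sub (UnitAddCircle.integrable_of_continuous (by fun_prop))
        (UnitAddCircle.integrable_of_continuous (by fun_prop))
    have : (2 * π * Complex.I * k) ≠ 0 := by
      simp [Complex.I_ne_zero, hk, Real.pi_ne_zero]
    rw [h2, h1, ← h k]
    field_simp
    simp
  have hconst : ∀ θ, f θ - Y θ = fourierCoeff (fun θ => f θ - Y θ) 0 := by
    intro θ
    set P : C(UnitAddCircle, ℂ) := ⟨fun θ => f θ - Y θ, hf.sub hYc⟩ with hP
    have h3 : ∀ k ∉ ({0} : Finset ℤ), fourierCoeff P k = 0 := fun k hk =>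
      hcoef k (by simpa using hk)
    have h4 := has_pointwise_sum_fourier_series_of_summable (f := P)
      (summable_of_ne_finset_zero h3) θ
    have h5 : HasSum (fun k : ℤ => fourierCoeff P k • fourier k θ)
        (∑ k ∈ ({0} : Finset ℤ), fourierCoeff P k • fourier k θ) :=
      hasSum_sum_of_ne_finset_zero fun k hk => by rw [h3 k hk, zero_smul]
    have h6 := h4.unique h5
    rw [Finset.sum_singleton, fourier_zero, smul_eq_mul, mul_one] at h6
    exact h6
  have hfin : (fun s : ℝ => f s) = fun s : ℝ => y s + fourierCoeff (fun θ => f θ - Y θ) 0 := by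
    ext s
    rw [← hconst s, hYt]
    ring
  rw [hfin]
  exact (hyd t).add_const _

theorem fourierCoeff_inner_left {E : Type*} [NormedAddCommGroup E] [InnerProductSpace ℂ E]
    [CompleteSpace E] {f : UnitAddCircle → E} (hf : Continuous f) (v : E) (k : ℤ) :
    fourierCoeff (fun θ => ⟪v, f θ⟫_ℂ) k = ⟪v, fourierCoeff f k⟫_ℂ := by
  rw [fourierCoeff, fourierCoeff,
    ← integral_inner (UnitAddCircle.integrable_of_continuous (by fun_prop))]
  simp only [inner_smul_right, smul_eq_mul]

attribute [local instance] InnerProductSpace.complexToReal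

variable {E : Type*} [NormedAddCommGroup E] [InnerProductSpace ℂ E]
  {H : E → ℝ} {G : E → E} {C K : ℝ}

theorem UnitAddCircle.hasDerivAt_of_fourierCoeff [CompleteSpace E] {f g : UnitAddCircle → E}
    (hf : Continuous f) (hg : Continuous g)
    (h : ∀ k : ℤ, (2 * π * k : ℝ) • Complex.I • fourierCoeff f k = fourierCoeff g k) (t : ℝ) :
    HasDerivAt (fun s : ℝ => f s) (g t) t := by
  have hgc : Continuous fun s : ℝ => g s := hg.comp (AddCircle.continuous_mk' 1)
  set y : ℝ → E := fun t => f (0 : ℝ) + ∫ s in (0 : ℝ)..t, g s with hy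
  have hyd : ∀ t : ℝ, HasDerivAt y (g t) t := fun t =>
    (intervalIntegral.integral_hasDerivAt_right (hgc.intervalIntegrable _ _)
      (hgc.stronglyMeasurableAtFilter _ _) hgc.continuousAt).const_add _
  suffices (fun s : ℝ => f s) = y by rw [this]; exact hyd t
  ext s
  refine ext_inner_left ℂ fun v => ?_
  have h1 : ∀ s : ℝ, HasDerivAt (fun s : ℝ => ⟪v, f s⟫_ℂ) ⟪v, g s⟫_ℂ s := by
    refine UnitAddCircle.hasDerivAt_of_fourierCoeff_complex (f := fun θ => ⟪v, f θ⟫_ℂ)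
      (g := fun θ => ⟪v, g θ⟫_ℂ) (continuous_const.inner hf) (continuous_const.inner hg)
      fun k => ?_
    rw [fourierCoeff_inner_left hf, fourierCoeff_inner_left hg, ← h k,
      ← Complex.coe_smul, inner_smul_right, inner_smul_right]
    push_cast
    ring
  have h2 : ∀ s : ℝ, HasDerivAt (fun s : ℝ => ⟪v, y s⟫_ℂ) ⟪v, g s⟫_ℂ s := fun s => by
    simpa using (hasDerivAt_const s v).inner ℂ (hyd s)
  have h3 := is_const_of_deriv_eq_zero (f := fun s : ℝ => ⟪v, f s⟫_ℂ - ⟪v, y s⟫_ℂ)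
    (fun s => ((h1 s).sub (h2 s)).differentiableAt)
    (fun s => ((h1 s).sub (h2 s)).deriv.trans (sub_self _)) s 0
  simp only [hy, intervalIntegral.integral_same, add_zero, sub_self] at h3
  exact sub_eq_zero.1 h3

theorem exists_periodic_solution [FiniteDimensional ℂ E] [Nontrivial E]
    (h : IsQuadraticHamiltonian H G C K) :
    ∃ (x : ℝ → E) (T : ℝ), 0 < T ∧ T ≤ π ∧ Function.Periodic x 1 ∧
      (∀ t, HasDerivAt x (T • Complex.I • G (x t)) t) ∧ ∀ t, H (x t) = 1 := by
  have : CompleteSpace E := FiniteDimensional.complete ℂ E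
  obtain ⟨x, T, hx, hT0, hTπ, hH, hk⟩ := exists_weak_periodic_solution h
  have hGx : Continuous fun θ => G (x θ) := h.continuous_gradient.comp hx
  have hd : ∀ t : ℝ, HasDerivAt (fun s : ℝ => x s) (T • Complex.I • G (x t)) t := by
    refine UnitAddCircle.hasDerivAt_of_fourierCoeff (g := fun θ => T • Complex.I • G (x θ)) hx
      ((hGx.const_smul _).const_smul _) fun k => ?_
    rw [smul_comm, hk k]
    have h1 : (fun θ => T • Complex.I • G (x θ)) = (T * Complex.I : ℂ) • fun θ => G (x θ) := by
      ext θ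
      rw [Pi.smul_apply, mul_smul, Complex.coe_smul]
    rw [h1, fourierCoeff.const_smul, mul_smul, Complex.coe_smul, smul_comm]
  have hHd : ∀ t : ℝ, HasDerivAt (fun s : ℝ => H (x s)) 0 t := fun t => by
    have h1 := (h.hasFDerivAt (x t)).comp_hasDerivAt t (hd t)
    have h2 : (innerSL ℝ (G (x t))) (T • Complex.I • G (x t)) = 0 := by
      simp only [innerSL_apply_apply, inner_smul_right]
      rw [real_inner_eq_re_inner ℂ, inner_smul_right, inner_self_eq_norm_sq_to_K]
      simp [← Complex.ofReal_pow]
    rw [h2] at h1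
    exact h1
  have hHc : ∀ t : ℝ, H (x t) = H (x (0 : ℝ)) := fun t =>
    is_const_of_deriv_eq_zero (fun s => (hHd s).differentiableAt) (fun s => (hHd s).deriv) t 0
  have hHc' : ∀ θ, H (x θ) = H (x (0 : ℝ)) := fun θ => by
    induction θ using QuotientAddGroup.induction_on with
    | H t => exact hHc t
  have hH1 : H (x (0 : ℝ)) = 1 := by
    simp only [hHc'] at hH
    simpa using hH
  refine ⟨fun s => x s, T, hT0, hTπ, fun s => by simp, hd,
    fun t => by rw [hHc, hH1]⟩

end StrongSolution

section Transfer

open scoped InnerProductSpace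

section Abstract

attribute [local instance] InnerProductSpace.complexToReal

variable {E V : Type*} [NormedAddCommGroup E] [InnerProductSpace ℂ E] [NormedAddCommGroup V]
  [InnerProductSpace ℝ V] {H : V → ℝ} {G : V → V} {C K : ℝ}

theorem IsQuadraticHamiltonian.comp_linearIsometryEquiv (h : IsQuadraticHamiltonian H G C K)
    (Φ : E ≃ₗᵢ[ℝ] V) :
    IsQuadraticHamiltonian (fun x => H (Φ x)) (fun x => Φ.symm (G (Φ x))) C K where
  continuous_gradient := Φ.symm.continuous.comp (h.continuous_gradient.comp Φ.continuous)
  remainder u v := by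
    have := h.remainder (Φ u) (Φ v)
    rwa [← map_sub, Φ.norm_map, ← Φ.apply_symm_apply (G (Φ u)), Φ.inner_map_map] at this
  homogeneous c u hc := by rw [map_smul, h.homogeneous c _ hc]
  gradient_homogeneous c u hc := by rw [map_smul, h.gradient_homogeneous c _ hc, map_smul]
  euler u := by
    rw [← Φ.inner_map_map, Φ.apply_symm_apply]
    exact h.euler _
  norm_sq_le u := by simpa using h.norm_sq_le (Φ u)
  gradient_le u := by simpa using h.gradient_le (Φ u)

theorem IsQuadraticHamiltonian.exists_periodic_solution [FiniteDimensional ℂ E] [Nontrivial E]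
    (h : IsQuadraticHamiltonian H G C K) (Φ : E → V) (Ψ : V → E)
    (hΦΨ : Function.LeftInverse Φ Ψ) (hΨΦ : Function.RightInverse Φ Ψ)
    (hadd : ∀ x y, Φ (x + y) = Φ x + Φ y) (hsmul : ∀ (r : ℝ) x, Φ ((r : ℂ) • x) = r • Φ x)
    (hnorm : ∀ x, ‖Φ x‖ = ‖x‖) :
    ∃ (x : ℝ → V) (T : ℝ), 0 < T ∧ T ≤ π ∧ Function.Periodic x 1 ∧
      (∀ t, HasDerivAt x (T • Φ (Complex.I • Ψ (G (x t)))) t) ∧ ∀ t, H (x t) = 1 := by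
  let L : E ≃ₗᵢ[ℝ] V :=
    { toFun := Φ
      invFun := Ψ
      left_inv := hΨΦ
      right_inv := hΦΨ
      map_add' := hadd
      map_smul' := fun r x => by rw [← Complex.coe_smul, hsmul, RingHom.id_apply]
      norm_map' := hnorm }
  obtain ⟨x, T, hT0, hTπ, hx, hd, hH⟩ :=
    _root_.exists_periodic_solution (h.comp_linearIsometryEquiv L)
  refine ⟨fun t => L (x t), T, hT0, hTπ, fun t => by simp only [hx t], fun t => ?_, hH⟩
  have h1 := L.toContinuousLinearEquiv.toContinuousLinearMap.hasFDerivAt.comp_hasDerivAt t (hd t)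
  have h2 : L.toContinuousLinearEquiv.toContinuousLinearMap
      (T • Complex.I • L.symm (G (L (x t)))) = T • L (Complex.I • L.symm (G (L (x t)))) :=
    map_smul L _ _
  rw [h2] at h1
  exact h1

end Abstract

/-- Multiplication by `i` on `ℝ⁴ = ℂ²`. -/
def rotI (v : R4) : R4 := !₂[-v 1, v 0, -v 3, v 2]

theorem inner_rotI (u v : R4) : ⟪rotI u, v⟫_ℝ = omegaSt u v := by
  simp [rotI, omegaSt, PiLp.inner_apply, Fin.sum_univ_four]
  ring

theorem omegaSt_self (u : R4) : omegaSt u u = 0 := by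
  unfold omegaSt
  ring

theorem omegaSt_rotI_left (u v : R4) : omegaSt (rotI u) v = -inner ℝ u v := by
  simp [rotI, omegaSt, PiLp.inner_apply, Fin.sum_univ_four]
  ring

theorem omegaSt_rotI_right (u v : R4) : omegaSt u (rotI v) = inner ℝ u v := by
  simp [rotI, omegaSt, PiLp.inner_apply, Fin.sum_univ_four]
  ring

theorem contDiff_rotI : ContDiff ℝ ∞ rotI := by
  rw [contDiff_euclidean]
  intro i
  fin_cases i <;> simp [rotI] <;> fun_prop

theorem exists_hamiltonian_orbit {H : R4 → ℝ} {G : R4 → R4} {C K : ℝ}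
    (h : IsQuadraticHamiltonian H G C K) :
    ∃ (x : ℝ → R4) (T : ℝ), 0 < T ∧ T ≤ π ∧ Function.Periodic x T ∧
      (∀ t, HasDerivAt x (rotI (G (x t))) t) ∧ ∀ t, H (x t) = 1 := by
  obtain ⟨x, T, hT0, hTπ, hx, hd, hH⟩ := h.exists_periodic_solution
    (E := EuclideanSpace ℂ (Fin 2))
    (fun z => !₂[(z 0).re, (z 0).im, (z 1).re, (z 1).im])
    (fun v => !₂[⟨v 0, v 1⟩, ⟨v 2, v 3⟩])
    (fun v => by ext i; fin_cases i <;> rfl) (fun z => by ext i; fin_cases i <;> rfl)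
    (fun z w => by ext i; fin_cases i <;> simp) (fun r z => by ext i; fin_cases i <;> simp)
    (fun z => by
      simp only [EuclideanSpace.norm_eq, Fin.sum_univ_four, Fin.sum_univ_two, Complex.sq_norm,
        Complex.normSq_apply, Real.norm_eq_abs, sq_abs]
      simp
      ring_nf)
  have hd' : ∀ t, HasDerivAt x (T • rotI (G (x t))) t := fun t => (hd t).congr_deriv <| by
    congr 1
    ext i
    fin_cases i <;> simp [rotI]
  refine ⟨fun t => x (T⁻¹ * t), T, hT0, hTπ, fun t => ?_, fun t => ?_, fun t => hH _⟩
  · simp only [mul_add, inv_mul_cancel₀ hT0.ne']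
    exact hx _
  · refine ((hd' (T⁻¹ * t)).scomp t ((hasDerivAt_id t).const_mul T⁻¹)).congr_deriv ?_
    rw [smul_smul, mul_one, inv_mul_cancel₀ hT0.ne', one_smul]

end Transfer

section Homogeneous

open scoped InnerProductSpace Topology

variable {E F : Type*} [NormedAddCommGroup E] [NormedSpace ℝ E] [NormedAddCommGroup F]
  [NormedSpace ℝ F]

theorem fderiv_smul_of_homogeneous {f : E → F} {n : ℕ}
    (hf : ∀ (c : ℝ) u, 0 < c → f (c • u) = c ^ (n + 1) • f u) {c : ℝ} (hc : 0 < c) (u : E) :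
    fderiv ℝ f (c • u) = c ^ n • fderiv ℝ f u := by
  have h1 : fderiv ℝ (fun x => f (c • x)) u = c • fderiv ℝ f (c • u) := fderiv_comp_smul _
  have h2 : (fun x => f (c • x)) = c ^ (n + 1) • f := by
    ext x
    exact hf c x hc
  rw [h2, fderiv_const_smul_field, pow_succ', mul_smul] at h1
  exact (smul_right_injective _ hc.ne' h1).symm

theorem exists_bound_of_homogeneous [FiniteDimensional ℝ E] {f : E → F} {n : ℕ}
    (hf : ∀ (c : ℝ) u, 0 < c → f (c • u) = c ^ n • f u) (hc : ∀ u, u ≠ 0 → ContinuousAt f u) :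
    ∃ K, 0 ≤ K ∧ ∀ u, u ≠ 0 → ‖f u‖ ≤ K * ‖u‖ ^ n := by
  have : ProperSpace E := FiniteDimensional.proper ℝ E
  obtain ⟨K, hK⟩ := (isCompact_sphere (0 : E) 1).exists_bound_of_continuousOn (f := f)
    fun u hu => (hc u (ne_zero_of_mem_unit_sphere ⟨u, hu⟩)).continuousWithinAt
  refine ⟨max K 0, le_max_right _ _, fun u hu => ?_⟩
  have hu' : 0 < ‖u‖ := norm_pos_iff.2 hu
  have h1 := hf ‖u‖ (‖u‖⁻¹ • u) hu'
  rw [smul_inv_smul₀ hu'.ne'] at h1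
  have h2 := hK (‖u‖⁻¹ • u) (by simp [norm_smul, hu'.ne'])
  rw [h1, norm_smul, norm_pow, norm_norm, mul_comm]
  exact mul_le_mul_of_nonneg_right (h2.trans (le_max_left _ _)) (by positivity)

/-- A positively `1`-homogeneous map vanishing at `0` and `C¹` away from `0` is Lipschitz. -/
theorem exists_lipschitz_of_homogeneous [FiniteDimensional ℝ E] {f : E → F}
    (hf : ∀ (c : ℝ) u, 0 < c → f (c • u) = c • f u) (hf0 : f 0 = 0)
    (hd : ∀ u, u ≠ 0 → ContDiffAt ℝ 1 f u) :
    ∃ K, 0 ≤ K ∧ ∀ u v, ‖f v - f u‖ ≤ K * ‖v - u‖ := by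
  obtain ⟨K, hK0, hK⟩ := exists_bound_of_homogeneous (f := f) (n := 1)
    (by simpa using hf) fun u hu => (hd u hu).continuousAt
  have hK' : ∀ u, ‖f u‖ ≤ K * ‖u‖ := fun u => by
    rcases eq_or_ne u 0 with rfl | hu
    · simp [hf0]
    · simpa using hK u hu
  obtain ⟨L, hL0, hL⟩ := exists_bound_of_homogeneous (f := fderiv ℝ f) (n := 0)
    (fun c u hc => fderiv_smul_of_homogeneous (n := 0) (by simpa using hf) hc u)
    fun u hu => (hd u hu).continuousAt_fderiv (by simp)
  refine ⟨max K L, le_max_of_le_left hK0, fun u v => ?_⟩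
  by_cases h0 : (0 : E) ∈ segment ℝ u v
  · have h1 := dist_add_dist_of_mem_segment h0
    rw [dist_zero_right, dist_zero_left, dist_eq_norm, norm_sub_rev] at h1
    calc ‖f v - f u‖ ≤ ‖f v‖ + ‖f u‖ := norm_sub_le _ _
      _ ≤ K * ‖v‖ + K * ‖u‖ := add_le_add (hK' v) (hK' u)
      _ = K * ‖v - u‖ := by rw [← h1]; ring
      _ ≤ _ := mul_le_mul_of_nonneg_right (le_max_left _ _) (norm_nonneg _)
  · have hne : ∀ w ∈ segment ℝ u v, w ≠ 0 := fun w hw h => h0 (h ▸ hw)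
    refine ((convex_segment u v).norm_image_sub_le_of_norm_fderiv_le (C := L)
      (fun w hw => (hd w (hne w hw)).differentiableAt (by simp))
      (fun w hw => by simpa using hL w (hne w hw)) (left_mem_segment ℝ u v)
      (right_mem_segment ℝ u v)).trans ?_
    exact mul_le_mul_of_nonneg_right (le_max_right _ _) (norm_nonneg _)

theorem exists_isQuadraticHamiltonian {E : Type*} [NormedAddCommGroup E] [InnerProductSpace ℝ E]
    [FiniteDimensional ℝ E] [CompleteSpace E] {H : E → ℝ}
    (hH : ∀ (c : ℝ) u, 0 ≤ c → H (c • u) = c ^ 2 * H u) (hn : ∀ u, ‖u‖ ^ 2 ≤ H u)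
    (hd : ∀ u, u ≠ 0 → ContDiffAt ℝ 2 H u) :
    ∃ C K, IsQuadraticHamiltonian H (gradient H) C K := by
  have hD : ∀ (c : ℝ) u, 0 < c → fderiv ℝ H (c • u) = c • fderiv ℝ H u := fun c u hc => by
    simpa using fderiv_smul_of_homogeneous (n := 1) (fun c u hc => hH c u hc.le) hc u
  have hD0 : fderiv ℝ H 0 = 0 := by
    have h := hD 2 0 two_pos
    rw [smul_zero, two_smul] at h
    simpa using h
  obtain ⟨K, hK0, hK⟩ := exists_lipschitz_of_homogeneous hD hD0
    fun u hu => (hd u hu).fderiv_right (m := 1) (by norm_num)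
  have hK' : ∀ u, ‖fderiv ℝ H u‖ ≤ K * ‖u‖ := fun u => by simpa [hD0] using hK 0 u
  have hH0 : H 0 = 0 := by simpa using hH 0 0 le_rfl
  have heuler : ∀ u, fderiv ℝ H u u = 2 * H u := by
    intro u
    rcases eq_or_ne u 0 with rfl | hu
    · simp [hH0]
    have h1 : HasDerivAt (fun c : ℝ => H (c • u)) (fderiv ℝ H u u) 1 := by
      have h2 : HasFDerivAt H (fderiv ℝ H u) ((1 : ℝ) • u) := by
        rw [one_smul]
        exact ((hd u hu).differentiableAt (by simp)).hasFDerivAt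
      exact (h2.comp_hasDerivAt 1 ((hasDerivAt_id (1 : ℝ)).smul_const u)).congr_deriv
        (by rw [one_smul])
    have h2 : HasDerivAt (fun c : ℝ => c ^ 2 * H u) (2 * H u) 1 := by
      simpa using (hasDerivAt_pow 2 (1 : ℝ)).mul_const (H u)
    refine h1.unique (h2.congr_of_eventuallyEq ?_)
    filter_upwards [lt_mem_nhds (zero_lt_one' ℝ)] with c hc
    exact hH c u hc.le
  have hdiff : ∀ u, HasFDerivAt H (fderiv ℝ H u) u := by
    intro u
    rcases eq_or_ne u 0 with rfl | hu
    · rw [hD0]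
      refine Asymptotics.IsBigO.hasFDerivAt (n := 2) ?_ one_lt_two
      refine Asymptotics.IsBigO.of_bound (K / 2) (Filter.Eventually.of_forall fun u => ?_)
      have h1 := (fderiv ℝ H u).le_opNorm u
      have h2 := mul_le_mul_of_nonneg_right (hK' u) (norm_nonneg u)
      rw [heuler, norm_mul, Real.norm_two] at h1
      rw [sub_zero, norm_pow, norm_norm]
      nlinarith
    · exact ((hd u hu).differentiableAt (by simp)).hasFDerivAt
  have hinner : ∀ u v, ⟪gradient H u, v⟫_ℝ = fderiv ℝ H u v := fun u v => by
    rw [gradient, InnerProductSpace.toDual_symm_apply]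
  refine ⟨K, K, ?_, fun u v => ?_, hH, fun c u hc => ?_, fun u => ?_, hn, fun u => ?_⟩
  · refine (LinearIsometryEquiv.continuous _).comp (LipschitzWith.continuous (K := ⟨K, hK0⟩) ?_)
    exact LipschitzWith.of_dist_le_mul fun u v => by
      rw [dist_eq_norm, dist_eq_norm]
      exact hK v u
  · rw [hinner]
    have := (convex_segment u v).norm_image_sub_le_of_norm_hasFDerivWithin_le'
      (f := H) (f' := fderiv ℝ H) (φ := fderiv ℝ H u) (C := K * ‖v - u‖)
      (fun w _ => (hdiff w).hasFDerivWithinAt) (fun w hw => ?_) (left_mem_segment ℝ u v)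
      (right_mem_segment ℝ u v)
    · rw [Real.norm_eq_abs] at this
      linarith [mul_assoc K ‖v - u‖ ‖v - u‖]
    · refine (hK u w).trans (mul_le_mul_of_nonneg_left ?_ hK0)
      have h1 := dist_add_dist_of_mem_segment hw
      rw [dist_eq_norm, dist_eq_norm, dist_eq_norm, norm_sub_rev u w, norm_sub_rev u v] at h1
      linarith [norm_nonneg (w - v)]
  · rcases hc.eq_or_lt with rfl | hc
    · rw [zero_smul, zero_smul, gradient, hD0, map_zero]
    · rw [gradient, hD c u hc, map_smul, gradient]
  · rw [hinner, heuler]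
  · rw [gradient, LinearIsometryEquiv.norm_map]
    exact hK' u

end Homogeneous

section RadialTime

open Topology Filter Set

variable {E : Type*} [NormedAddCommGroup E] [NormedSpace ℝ E] {g : E → ℝ}

/-- The zero set of `g` is a nonempty compact hypersurface in the open unit ball which is
transverse to the radial vector field. -/
structure IsRadialHypersurface (g : E → ℝ) : Prop where
  contDiff : ContDiff ℝ ∞ g
  nonempty : ∃ x, g x = 0
  norm_lt_one : ∀ x, g x = 0 → ‖x‖ < 1
  transverse : ∀ x, g x = 0 → fderiv ℝ g x x ≠ 0

/-- The first positive time at which the ray through `x` meets the zero set of `g`. -/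
def radialTime (g : E → ℝ) (x : E) : ℝ := sInf {t : ℝ | 0 < t ∧ g (t • x) = 0}

open scoped Pointwise in
theorem radialTime_smul (c : ℝ) (x : E) (hc : 0 < c) :
    radialTime g (c • x) = c⁻¹ * radialTime g x := by
  have h : {t : ℝ | 0 < t ∧ g (t • c • x) = 0} = c⁻¹ • {t : ℝ | 0 < t ∧ g (t • x) = 0} := by
    ext t
    rw [Set.mem_inv_smul_set_iff₀ hc.ne']
    simp only [Set.mem_ofPred_eq, smul_smul, smul_eq_mul, mul_comm c, mul_pos_iff_of_pos_right hc]
  rw [radialTime, h, Real.sInf_smul_of_nonneg (inv_pos.2 hc).le, smul_eq_mul, radialTime]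

theorem exists_contDiffAt_zero_of_transverse [CompleteSpace E] (hg : ContDiff ℝ ∞ g) {x₀ : E}
    {t₀ : ℝ} (h0 : g (t₀ • x₀) = 0) (h1 : fderiv ℝ g (t₀ • x₀) x₀ ≠ 0) :
    ∃ ψ : E → ℝ, ContDiffAt ℝ ∞ ψ x₀ ∧ ψ x₀ = t₀ ∧ (∀ᶠ x in 𝓝 x₀, g (ψ x • x) = 0) ∧
      ∀ᶠ v : E × ℝ in 𝓝 (x₀, t₀), g (v.2 • v.1) = 0 → ψ v.1 = v.2 := by
  set f : E × ℝ → ℝ := fun v => g (v.2 • v.1) with hf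
  have hfc : ContDiff ℝ ∞ f := hg.comp (contDiff_snd.smul contDiff_fst)
  have hfd : fderiv ℝ f (x₀, t₀) (0, 1) = fderiv ℝ g (t₀ • x₀) x₀ := by
    have h2 : HasFDerivAt g (fderiv ℝ g (t₀ • x₀)) (t₀ • x₀) :=
      (hg.differentiable (by simp)).differentiableAt.hasFDerivAt
    have h3 : HasFDerivAt (fun v : E × ℝ => v.2 • v.1) _ (x₀, t₀) :=
      (hasFDerivAt_snd (𝕜 := ℝ) (p := (x₀, t₀))).smul hasFDerivAt_fst
    have h4 : HasFDerivAt f _ (x₀, t₀) := HasFDerivAt.comp (x₀, t₀) h2 h3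
    rw [h4.fderiv]
    simp
  have hinv : (fderiv ℝ f (x₀, t₀) ∘L .inr ℝ E ℝ).IsInvertible := by
    refine ⟨ContinuousLinearEquiv.unitsEquivAut ℝ (Units.mk0 _ h1), ?_⟩
    ext
    simp [hfd]
  have hcd : ContDiffAt ℝ ∞ f (x₀, t₀) := hfc.contDiffAt
  have hf0 : f (x₀, t₀) = 0 := h0
  refine ⟨hcd.implicitFunction (by simp) hinv, hcd.contDiffAt_implicitFunction (by simp) hinv,
    hcd.implicitFunction_apply_self (by simp) hinv, ?_, ?_⟩
  · have := hcd.eventually_apply_implicitFunction (by simp) hinv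
    rwa [hf0] at this
  · filter_upwards [hcd.eventually_apply_eq_iff_implicitFunction (by simp) hinv] with v hv h
    rw [hf0] at hv
    exact hv.1 h

theorem eventually_forall_smul_ne_zero (hg : Continuous g) {x₀ : E} {K : Set ℝ} (hK : IsCompact K)
    (h : ∀ t ∈ K, g (t • x₀) ≠ 0) : ∀ᶠ x in 𝓝 x₀, ∀ t ∈ K, g (t • x) ≠ 0 := by
  refine hK.eventually_forall_of_forall_eventually fun t ht => ?_
  have hc : Continuous fun z : E × ℝ => g (z.2 • z.1) := by fun_prop
  exact hc.continuousAt.eventually_ne (h t ht)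

namespace IsRadialHypersurface

theorem apply_zero_ne (h : IsRadialHypersurface g) : g 0 ≠ 0 := fun h0 =>
  h.transverse 0 h0 (map_zero _)

theorem mul_norm_lt_one (h : IsRadialHypersurface g) {t : ℝ} {x : E} (ht : 0 ≤ t)
    (hx : g (t • x) = 0) : t * ‖x‖ < 1 := by
  have := h.norm_lt_one _ hx
  rwa [norm_smul, Real.norm_of_nonneg ht] at this

theorem fderiv_smul_ne_zero (h : IsRadialHypersurface g) {t : ℝ} {x : E}
    (hx : g (t • x) = 0) : fderiv ℝ g (t • x) x ≠ 0 := fun h1 =>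
  h.transverse _ hx (by rw [map_smul, h1, smul_zero])

theorem exists_pos_smul_eq_zero [CompleteSpace E] (h : IsRadialHypersurface g)
    (hE : 1 < Module.rank ℝ E) {x : E} (hx : x ≠ 0) : ∃ t : ℝ, 0 < t ∧ g (t • x) = 0 := by
  set S : Set E := {x | ∃ t : ℝ, 0 < t ∧ g (t • x) = 0} with hS
  have hSo : IsOpen S := by
    refine isOpen_iff_mem_nhds.2 fun x₀ ⟨t₀, ht₀, h0⟩ => ?_
    obtain ⟨ψ, h1, h2, h3, -⟩ :=
      exists_contDiffAt_zero_of_transverse h.contDiff h0 (h.fderiv_smul_ne_zero h0)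
    filter_upwards [h3, h1.continuousAt.eventually (lt_mem_nhds (h2.symm ▸ ht₀))] with y hy hy'
    exact ⟨ψ y, hy', hy⟩
  set S' : Set E := {x | x ≠ 0 ∧ ∀ t : ℝ, 0 ≤ t → g (t • x) ≠ 0} with hS'
  have hSo' : IsOpen S' := by
    refine isOpen_iff_mem_nhds.2 fun x₀ ⟨hx₀, h0⟩ => ?_
    have hn : 0 < ‖x₀‖ := norm_pos_iff.2 hx₀
    have h1 := eventually_forall_smul_ne_zero h.contDiff.continuous
      (isCompact_Icc (a := (0 : ℝ)) (b := 2 / ‖x₀‖)) fun t ht => h0 t ht.1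
    have h2 : ∀ᶠ x in 𝓝 x₀, ‖x₀‖ / 2 < ‖x‖ :=
      continuous_norm.continuousAt.eventually (lt_mem_nhds (half_lt_self hn))
    filter_upwards [h1, h2] with y hy hy'
    refine ⟨norm_pos_iff.1 ((half_pos hn).trans hy'), fun t ht h3 => ?_⟩
    refine hy t ⟨ht, ?_⟩ h3
    have h4 := h.mul_norm_lt_one ht h3
    rw [le_div_iff₀ hn]
    nlinarith
  have hsub : ({0}ᶜ : Set E) ⊆ S := by
    have hconn := isConnected_compl_singleton_of_one_lt_rank hE (0 : E)
    refine hconn.isPreconnected.subset_left_of_subset_union hSo hSo' ?_ (fun y hy => ?_) ?_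
    · rw [Set.disjoint_left]
      rintro y ⟨t, ht, h1⟩ ⟨-, h2⟩
      exact h2 t ht.le h1
    · by_cases hyS : y ∈ S
      · exact Or.inl hyS
      · refine Or.inr ⟨hy, fun t ht h1 => ?_⟩
        rcases ht.eq_or_lt with rfl | ht
        · rw [zero_smul] at h1
          exact h.apply_zero_ne h1
        · exact hyS ⟨t, ht, h1⟩
    · obtain ⟨y, hy⟩ := h.nonempty
      exact ⟨y, fun h0 => h.apply_zero_ne (h0 ▸ hy), 1, one_pos, by rwa [one_smul]⟩
  exact hsub hx

theorem radialTime_mem [CompleteSpace E] (h : IsRadialHypersurface g)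
    (hE : 1 < Module.rank ℝ E) {x : E} (hx : x ≠ 0) :
    0 < radialTime g x ∧ g (radialTime g x • x) = 0 := by
  have h1 : {t : ℝ | 0 < t ∧ g (t • x) = 0} = {t : ℝ | 0 ≤ t ∧ g (t • x) = 0} := by
    ext t
    refine ⟨fun h => ⟨h.1.le, h.2⟩, fun h2 => ⟨h2.1.lt_of_ne ?_, h2.2⟩⟩
    rintro rfl
    exact h.apply_zero_ne (by simpa using h2.2)
  have hc : Continuous fun t : ℝ => g (t • x) :=
    h.contDiff.continuous.comp (continuous_id.smul continuous_const)
  have h2 : IsClosed {t : ℝ | 0 < t ∧ g (t • x) = 0} := by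
    rw [h1]
    exact isClosed_Ici.inter (isClosed_singleton.preimage hc)
  exact h2.csInf_mem (h.exists_pos_smul_eq_zero hE hx) ⟨0, fun t ht => ht.1.le⟩

theorem radialTime_le {t : ℝ} {x : E} (ht : 0 < t) (hx : g (t • x) = 0) : radialTime g x ≤ t :=
  csInf_le ⟨0, fun _ ht => ht.1.le⟩ ⟨ht, hx⟩

theorem contDiffAt_radialTime [CompleteSpace E] (h : IsRadialHypersurface g)
    (hE : 1 < Module.rank ℝ E) {x₀ : E} (hx₀ : x₀ ≠ 0) : ContDiffAt ℝ ∞ (radialTime g) x₀ := by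
  obtain ⟨ht, h0⟩ := h.radialTime_mem hE hx₀
  obtain ⟨ψ, h1, h2, h3, h4⟩ :=
    exists_contDiffAt_zero_of_transverse h.contDiff h0 (h.fderiv_smul_ne_zero h0)
  have hne : ∀ᶠ x in 𝓝 x₀, x ≠ 0 := eventually_ne_nhds hx₀
  have htend : Tendsto (radialTime g) (𝓝 x₀) (𝓝 (radialTime g x₀)) := by
    refine tendsto_order.2 ⟨fun a ha => ?_, fun a ha => ?_⟩
    · have h5 := eventually_forall_smul_ne_zero h.contDiff.continuous
        (isCompact_Icc (a := (0 : ℝ)) (b := a)) (x₀ := x₀) fun t ht h6 => by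
          rcases ht.1.eq_or_lt with rfl | ht'
          · exact h.apply_zero_ne (by simpa using h6)
          · exact absurd (radialTime_le ht' h6) (not_le.2 (ht.2.trans_lt ha))
      filter_upwards [h5, hne] with y hy hy'
      by_contra! h6
      obtain ⟨h7, h8⟩ := h.radialTime_mem hE hy'
      exact hy _ ⟨h7.le, h6⟩ h8
    · filter_upwards [h3, h1.continuousAt.eventually (lt_mem_nhds (h2.symm ▸ ht)),
        h1.continuousAt.eventually (gt_mem_nhds (h2.symm ▸ ha))] with y hy hy1 hy2
      exact (radialTime_le hy1 hy).trans_lt hy2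
  refine h1.congr_of_eventuallyEq ?_
  filter_upwards [(tendsto_id.prodMk_nhds htend).eventually h4, hne] with y hy hy'
  exact (hy (h.radialTime_mem hE hy').2).symm

end IsRadialHypersurface

end RadialTime

section RadialHamiltonian

open scoped InnerProductSpace
open Topology Filter

/-- The `2`-homogeneous function which equals `1` on the first intersections of rays with the zero
set of `g`. -/
def radialHamiltonian {E : Type*} [NormedAddCommGroup E] [NormedSpace ℝ E] (g : E → ℝ) (x : E) :
    ℝ :=
  (radialTime g x)⁻¹ ^ 2

namespace IsRadialHypersurface

section Normed

variable {E : Type*} [NormedAddCommGroup E] [NormedSpace ℝ E] {g : E → ℝ}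

theorem radialHamiltonian_zero (h : IsRadialHypersurface g) : radialHamiltonian g 0 = 0 := by
  simp [radialHamiltonian, radialTime, h.apply_zero_ne]

theorem radialHamiltonian_smul (h : IsRadialHypersurface g) (c : ℝ) (u : E) (hc : 0 ≤ c) :
    radialHamiltonian g (c • u) = c ^ 2 * radialHamiltonian g u := by
  rcases hc.eq_or_lt with rfl | hc
  · simp [h.radialHamiltonian_zero]
  · rw [radialHamiltonian, radialTime_smul c u hc, mul_inv, inv_inv, mul_pow, radialHamiltonian]

theorem ne_zero_of_radialHamiltonian_eq_one (h : IsRadialHypersurface g) {x : E}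
    (hx : radialHamiltonian g x = 1) : x ≠ 0 := by
  rintro rfl
  rw [h.radialHamiltonian_zero] at hx
  exact zero_ne_one hx

variable [CompleteSpace E] {x : E}

theorem norm_sq_le_radialHamiltonian (h : IsRadialHypersurface g) (hE : 1 < Module.rank ℝ E)
    (x : E) : ‖x‖ ^ 2 ≤ radialHamiltonian g x := by
  rcases eq_or_ne x 0 with rfl | hx
  · simp [h.radialHamiltonian_zero]
  · obtain ⟨h1, h2⟩ := h.radialTime_mem hE hx
    refine pow_le_pow_left₀ (norm_nonneg _) ?_ 2
    rw [le_inv_comm₀ (norm_pos_iff.2 hx) h1, ← one_div, le_div_iff₀ (norm_pos_iff.2 hx)]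
    exact (h.mul_norm_lt_one h1.le h2).le

theorem contDiffAt_radialHamiltonian (h : IsRadialHypersurface g) (hE : 1 < Module.rank ℝ E)
    (hx : x ≠ 0) : ContDiffAt ℝ ∞ (radialHamiltonian g) x :=
  ((h.contDiffAt_radialTime hE hx).inv (h.radialTime_mem hE hx).1.ne').pow 2

theorem radialTime_eq_one (h : IsRadialHypersurface g) (hE : 1 < Module.rank ℝ E)
    (hx : radialHamiltonian g x = 1) : radialTime g x = 1 := by
  have h1 := (h.radialTime_mem hE (h.ne_zero_of_radialHamiltonian_eq_one hx)).1
  exact inv_eq_one.1 ((pow_eq_one_iff_of_nonneg (inv_pos.2 h1).le two_ne_zero).1 hx)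

theorem apply_eq_zero_of_radialHamiltonian_eq_one (h : IsRadialHypersurface g)
    (hE : 1 < Module.rank ℝ E) (hx : radialHamiltonian g x = 1) : g x = 0 := by
  have h1 := (h.radialTime_mem hE (h.ne_zero_of_radialHamiltonian_eq_one hx)).2
  rwa [h.radialTime_eq_one hE hx, one_smul] at h1

theorem fderiv_radialHamiltonian_mul (h : IsRadialHypersurface g) (hE : 1 < Module.rank ℝ E)
    (hx : radialHamiltonian g x = 1) (v : E) :
    fderiv ℝ (radialHamiltonian g) x v * fderiv ℝ g x x = 2 * fderiv ℝ g x v := by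
  have hx0 := h.ne_zero_of_radialHamiltonian_eq_one hx
  have hτ1 := h.radialTime_eq_one hE hx
  have hτ : HasFDerivAt (radialTime g) (fderiv ℝ (radialTime g) x) x :=
    ((h.contDiffAt_radialTime hE hx0).differentiableAt (by simp)).hasFDerivAt
  have hg : HasFDerivAt g (fderiv ℝ g x) ((radialTime g • id) x) := by
    rw [Pi.smul_apply', id]
    rw [hτ1, one_smul]
    exact (h.contDiff.differentiable (by simp)).differentiableAt.hasFDerivAt
  have h1 := hg.comp x (hτ.smul (hasFDerivAt_id x))
  have h2 : HasFDerivAt (fun y => g (radialTime g y • y)) (0 : E →L[ℝ] ℝ) x := by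
    refine (hasFDerivAt_const (0 : ℝ) x).congr_of_eventuallyEq ?_
    filter_upwards [eventually_ne_nhds hx0] with y hy
    exact (h.radialTime_mem hE hy).2
  have h3 := DFunLike.congr_fun (h1.unique h2) v
  have h4 : HasFDerivAt (radialHamiltonian g) _ x :=
    (((hasDerivAt_inv (h.radialTime_mem hE hx0).1.ne').pow 2).comp_hasFDerivAt x hτ)
  rw [h4.fderiv]
  simp [hτ1] at h3 ⊢
  linear_combination -2 * h3

end Normed

theorem exists_isQuadraticHamiltonian {E : Type*} [NormedAddCommGroup E] [InnerProductSpace ℝ E]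
    [FiniteDimensional ℝ E] [CompleteSpace E] {g : E → ℝ} (h : IsRadialHypersurface g)
    (hE : 1 < Module.rank ℝ E) :
    ∃ C K, IsQuadraticHamiltonian (radialHamiltonian g) (gradient (radialHamiltonian g)) C K :=
  _root_.exists_isQuadraticHamiltonian h.radialHamiltonian_smul
    (h.norm_sq_le_radialHamiltonian hE)
    fun _ hu => (h.contDiffAt_radialHamiltonian hE hu).of_le (WithTop.coe_le_coe.2 le_top)

end IsRadialHypersurface

end RadialHamiltonian

section Smoothness

theorem contDiff_of_hasDerivAt_comp {F : Type*} [NormedAddCommGroup F] [NormedSpace ℝ F]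
    {X : F → F} {γ : ℝ → F} (hγ : ∀ t, HasDerivAt γ (X (γ t)) t)
    (hX : ∀ t, ContDiffAt ℝ ∞ X (γ t)) : ContDiff ℝ ∞ γ := by
  refine contDiff_infty.2 fun n => ?_
  induction n with
  | zero => exact contDiff_zero.2 (continuous_iff_continuousAt.2 fun t => (hγ t).continuousAt)
  | succ n ih =>
    rw [Nat.cast_succ, contDiff_succ_iff_deriv]
    refine ⟨fun t => (hγ t).differentiableAt, by simp, ?_⟩
    have h1 : deriv γ = X ∘ γ := funext fun t => (hγ t).deriv
    rw [h1]
    refine contDiff_iff_contDiffAt.2 fun t => ContDiffAt.comp t ?_ ih.contDiffAt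
    exact (hX t).of_le (by exact_mod_cast le_top)

end Smoothness

section Contractible

variable {E : Type*} [NormedAddCommGroup E] [NormedSpace ℝ E]

/-- A smooth curve in a space of dimension greater than two misses some closed ray from `0`, up to
its origin. -/
theorem exists_smul_ne_of_contDiff [FiniteDimensional ℝ E] (hE : 2 < Module.finrank ℝ E)
    {γ : ℝ → E} (hγ : ContDiff ℝ 1 γ) (h0 : ∀ t, γ t ≠ 0) :
    ∃ p : E, p ≠ 0 ∧ ∀ (s : ℝ) t, s • p ≠ γ t := by
  have h1 : ContDiff ℝ 1 fun z : ℝ × ℝ => z.1 • γ z.2 :=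
    contDiff_fst.smul (hγ.comp contDiff_snd)
  have h2 := (h1.dense_compl_range_of_finrank_lt_finrank (by simpa using hE)).nonempty
  obtain ⟨p, hp⟩ := h2
  refine ⟨p, ?_, fun s t hst => ?_⟩
  · rintro rfl
    exact hp ⟨(0, 0), zero_smul _ _⟩
  · refine hp ⟨(s⁻¹, t), ?_⟩
    have hs : s ≠ 0 := by
      rintro rfl
      exact h0 t (by rw [← hst, zero_smul])
    change s⁻¹ • γ t = p
    rw [← hst, inv_smul_smul₀ hs]

theorem starConvex_compl_ray {p : E} (hp : p ≠ 0) :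
    StarConvex ℝ (-p) {x : E | ∀ s : ℝ, 0 ≤ s → s • p ≠ x} := by
  intro x hx a b ha hb hab s hs h
  rcases hb.eq_or_lt with rfl | hb
  · obtain rfl : a = 1 := by linarith
    have h1 : (s + 1) • p = 0 := by
      rw [add_smul, h]
      simp
    rcases smul_eq_zero.1 h1 with h2 | h2
    · linarith
    · exact hp h2
  · refine hx (b⁻¹ * (s + a)) (by positivity) ?_
    have h1 : (s + a) • p = b • x := by
      rw [add_smul, h]
      simp
    rw [mul_smul, h1, inv_smul_smul₀ (ne_of_gt hb)]

/-- A closed curve which misses a ray from `0` is null-homotopic in the image of any map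
defined away from `0` which fixes the curve. -/
theorem exists_nullhomotopic_loop {M : Set E} {γ : ℝ → E} {T : ℝ} (hγ : Continuous γ)
    (hT : γ T = γ 0) {p : E} (hp : p ≠ 0) (hpγ : ∀ (s : ℝ) t, s • p ≠ γ t) (r : E → E)
    (hr : ∀ x, x ≠ 0 → ContinuousAt r x) (hrM : ∀ x, x ≠ 0 → r x ∈ M) (hrγ : ∀ t, r (γ t) = γ t)
    (hmem : ∀ t, γ t ∈ M) :
    ∃ Γ : Path (⟨γ 0, hmem 0⟩ : M) (⟨γ 0, hmem 0⟩ : M),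
      (∀ s : I, (Γ s : E) = γ (T * (s : ℝ))) ∧ Γ.Homotopic (Path.refl _) := by
  set S : Set E := {x : E | ∀ s : ℝ, 0 ≤ s → s • p ≠ x} with hS
  have hSne : ∀ x ∈ S, x ≠ 0 := fun x hx h0 => hx 0 le_rfl (by rw [zero_smul, h0])
  have hγS : ∀ t, γ t ∈ S := fun t s _ => hpγ s t
  have hcon : ContractibleSpace S := (starConvex_compl_ray hp).contractibleSpace ⟨_, hγS 0⟩
  have hc : Continuous fun t : ℝ => (⟨γ t, hγS t⟩ : S) := hγ.subtype_mk _
  let Γ₀ : Path (⟨γ 0, hγS 0⟩ : S) ⟨γ 0, hγS 0⟩ :=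
    { toFun := fun s => ⟨γ (T * s), hγS _⟩
      continuous_toFun := hc.comp (continuous_const.mul continuous_subtype_val)
      source' := by simp
      target' := by simp [hT] }
  let R : C(S, M) :=
    ⟨fun x => ⟨r x, hrM _ (hSne _ x.2)⟩, by
      refine Continuous.subtype_mk (continuous_iff_continuousAt.2 fun x => ?_) _
      exact (hr _ (hSne _ x.2)).comp continuous_subtype_val.continuousAt⟩
  have hR : R ⟨γ 0, hγS 0⟩ = ⟨γ 0, hmem 0⟩ := Subtype.ext (hrγ 0)
  have hhom : Γ₀.Homotopic (Path.refl _) := SimplyConnectedSpace.paths_homotopic _ _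
  have h1 := hhom.map R
  refine ⟨(Γ₀.map R.continuous).cast hR.symm hR.symm, fun s => hrγ _, ?_⟩
  have h2 := h1.pathCast hR.symm hR.symm
  have h3 : ((Path.refl (⟨γ 0, hγS 0⟩ : S)).map R.continuous).cast hR.symm hR.symm
      = Path.refl (⟨γ 0, hmem 0⟩ : M) := by
    ext s
    exact hrγ 0
  rwa [h3] at h2

end Contractible

/-- Upper-bound half of the normalisation c₀(B⁴) = π: a compact hypersurface
M = g⁻¹(0) inside the open unit ball, transverse to the radial vector field,
carries a closed Reeb orbit of λ_st|TM of period at most π which is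
contractible in M. -/
theorem radial_contact_type_in_ball_short_contractible_reeb_orbit
    (g : R4 → ℝ) (hg : ContDiff ℝ ∞ g)
    (M : Set R4) (hM : M = g ⁻¹' {0})
    (hMne : M.Nonempty) (hMcpt : IsCompact M)
    (hMball : M ⊆ Metric.ball (0 : R4) 1)
    (hreg : ∀ x ∈ M, fderiv ℝ g x ≠ 0)
    (htrans : ∀ x ∈ M, fderiv ℝ g x x ≠ 0) :
    ∃ (T : ℝ) (γ : ℝ → R4), 0 < T ∧ T ≤ π ∧ ContDiff ℝ ∞ γ ∧ (∃ t s, γ t ≠ γ s) ∧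
      (∀ t, γ (t + T) = γ t) ∧
      -- γ′(t) is tangent to M:
      (∀ t, fderiv ℝ g (γ t) (deriv γ t) = 0) ∧
      -- γ′(t) lies in the kernel of ω_st restricted to T_{γ(t)}M:
      (∀ t, ∀ v : R4, fderiv ℝ g (γ t) v = 0 → omegaSt (deriv γ t) v = 0) ∧
      -- normalisation λ_st(γ)(γ′) = ½ ω_st(γ, γ′) = 1:
      (∀ t, (1 / 2) * omegaSt (γ t) (deriv γ t) = 1) ∧
      -- the image of γ lies in M, and the loop t ↦ γ(tT) is null-homotopic in M:
      ∃ hmem : ∀ t, γ t ∈ M,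
        ∃ Γ : Path (⟨γ 0, hmem 0⟩ : M) (⟨γ 0, hmem 0⟩ : M),
          (∀ s : I, (Γ s : R4) = γ (T * (s : ℝ))) ∧
          Γ.Homotopic (Path.refl _) := by
  subst hM
  have h : IsRadialHypersurface g :=
    { contDiff := hg
      nonempty := hMne
      norm_lt_one := fun x hx => mem_ball_zero_iff.1 (hMball hx)
      transverse := htrans }
  have hE : 1 < Module.rank ℝ R4 := by
    rw [← Module.finrank_eq_rank, finrank_euclideanSpace_fin]
    exact_mod_cast (by norm_num : 1 < 4)
  obtain ⟨C, K, hH⟩ := h.exists_isQuadraticHamiltonian hE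
  obtain ⟨γ, T, hT0, hTπ, hper, hd, h1⟩ := exists_hamiltonian_orbit hH
  have hne : ∀ t, γ t ≠ 0 := fun t => h.ne_zero_of_radialHamiltonian_eq_one (h1 t)
  have hmem : ∀ t, γ t ∈ g ⁻¹' {0} := fun t =>
    h.apply_eq_zero_of_radialHamiltonian_eq_one hE (h1 t)
  have hderiv : ∀ t, deriv γ t = rotI (gradient (radialHamiltonian g) (γ t)) := fun t =>
    (hd t).deriv
  have hgrad : ∀ x v, fderiv ℝ (radialHamiltonian g) x v
      = inner ℝ (gradient (radialHamiltonian g) x) v := fun x v => by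
    rw [gradient, InnerProductSpace.toDual_symm_apply]
  have hsmooth : ContDiff ℝ ∞ γ := by
    refine contDiff_of_hasDerivAt_comp
      (X := fun x => rotI (gradient (radialHamiltonian g) x)) hd fun t => ?_
    refine (contDiff_rotI).contDiffAt.comp (γ t) ?_
    exact (InnerProductSpace.toDual ℝ R4).symm.contDiff.contDiffAt.comp (γ t)
      ((h.contDiffAt_radialHamiltonian hE (hne t)).fderiv_right (m := ∞) (by simp))
  have hact : ∀ t, (1 / 2) * omegaSt (γ t) (deriv γ t) = 1 := fun t => by
    rw [hderiv, omegaSt_rotI_right, real_inner_comm, hH.euler, h1]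
    norm_num
  refine ⟨T, γ, hT0, hTπ, hsmooth, ?_, hper, fun t => ?_, fun t v hv => ?_, hact, hmem, ?_⟩
  · by_contra! hconst
    have h2 : γ = fun _ => γ 0 := funext fun t => hconst t 0
    have h3 := hact 0
    rw [h2] at h3
    simp [omegaSt] at h3
  · have h2 := h.fderiv_radialHamiltonian_mul hE (h1 t) (deriv γ t)
    rw [hgrad, hderiv, real_inner_comm, inner_rotI, omegaSt_self, zero_mul] at h2
    rw [hderiv]
    linarith
  · have h2 := h.fderiv_radialHamiltonian_mul hE (h1 t) v
    rw [hv, mul_zero, hgrad] at h2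
    rw [hderiv, omegaSt_rotI_left, (mul_eq_zero.1 h2).resolve_right (htrans _ (hmem t)), neg_zero]
  · obtain ⟨p, hp, hpγ⟩ := exists_smul_ne_of_contDiff (by simp) (hsmooth.of_le (by simp)) hne
    exact exists_nullhomotopic_loop hsmooth.continuous (by simpa using hper 0) hp hpγ
      (fun x => radialTime g x • x)
      (fun x hx => (h.contDiffAt_radialTime hE hx).continuousAt.smul continuousAt_id)
      (fun x hx => (h.radialTime_mem hE hx).2)
      (fun t => by simp only [h.radialTime_eq_one hE (h1 t), one_smul]) hmem
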